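/- arXiv:1711.07191 — 2 statements merged into one kernel-verified Lean document; each statement's English description precedes it below -/
import Mathlib

section
/- (Continuity of the Luttinger-Ward functional up to the boundary) The Luttinger-Ward functional Φ[G] = 2𝓕[G] - Tr[log G] - n log(2πe), defined on symmetric positive definite n×n matrices, extends to a continuous function on the closed cone of symmetric positive semidefinite n×n matrices. -/
open MeasureTheory Matrix Filter Topology Real Asymptotics

attribute [local instance] Matrix.normedAddCommGroup Matrix.normedSpace

noncomputable section

/-- The partition function `Z[A] = ∫ exp(-½ xᵀAx - U(x)) dx`. -/
def Zfun (n : ℕ) (U : (Fin n → ℝ) → ℝ) (A : Matrix (Fin n) (Fin n) ℝ) : ℝ :=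
  ∫ x : Fin n → ℝ, Real.exp (-(1 / 2) * (x ⬝ᵥ A.mulVec x) - U x)

/-- The free energy `Ω[A] = -log Z[A]`. -/
def Omega (n : ℕ) (U : (Fin n → ℝ) → ℝ) (A : Matrix (Fin n) (Fin n) ℝ) : ℝ :=
  - Real.log (Zfun n U A)

/-- `U` is continuous with superquadratic growth: for every `c > 0`,
`U x - c * |x|² → +∞` as `|x| → ∞`. -/
def SuperQuadratic {n : ℕ} (U : (Fin n → ℝ) → ℝ) : Prop :=
  Continuous U ∧ ∀ c : ℝ, 0 < c →
    Tendsto (fun x : Fin n → ℝ => U x - c * ‖x‖ ^ 2) (cocompact _) atTop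

/-- A probability density on `ℝⁿ` with finite second moments and finite
differential entropy. -/
def IsGoodDensity {n : ℕ} (ρ : (Fin n → ℝ) → ℝ) : Prop :=
  Measurable ρ ∧ (∀ x, 0 ≤ ρ x) ∧ (∫ x, ρ x) = 1 ∧
  (∀ i j : Fin n, Integrable fun x => x i * x j * ρ x) ∧
  Integrable fun x => ρ x * Real.log (ρ x)

/-- Differential entropy `S(ρ) = -∫ ρ log ρ`. -/
def entropy {n : ℕ} (ρ : (Fin n → ℝ) → ℝ) : ℝ := - ∫ x, ρ x * Real.log (ρ x)

/-- Second-moment matrix `𝒢(ρ) = ∫ x xᵀ ρ(x) dx`. -/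
def momMatrix {n : ℕ} (ρ : (Fin n → ℝ) → ℝ) : Matrix (Fin n) (Fin n) ℝ :=
  Matrix.of fun i j => ∫ x, x i * x j * ρ x

/-- `𝓕[G;U] = sup { S(ρ) - ∫ U ρ : ρ ∈ 𝓜, 𝒢(ρ) = G }`. -/
def Ffun (n : ℕ) (U : (Fin n → ℝ) → ℝ) (G : Matrix (Fin n) (Fin n) ℝ) : ℝ :=
  sSup { r : ℝ | ∃ ρ : (Fin n → ℝ) → ℝ, IsGoodDensity ρ ∧
    (Integrable fun x => U x * ρ x) ∧ momMatrix ρ = G ∧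
    r = entropy ρ - ∫ x, U x * ρ x }

/-- The Luttinger-Ward functional `Φ[G;U] = 2𝓕[G;U] - Tr[log G] - n log(2πe)`.
(For positive definite `G`, `Tr[log G] = log det G`.) -/
def Phi (n : ℕ) (U : (Fin n → ℝ) → ℝ) (G : Matrix (Fin n) (Fin n) ℝ) : ℝ :=
  2 * Ffun n U G - Real.log G.det - (n : ℝ) * Real.log (2 * π * Real.exp 1)

/-- The continuous linear functional `H ↦ Tr[S * H]` on matrices. -/
def tracePairing {n : ℕ} (S : Matrix (Fin n) (Fin n) ℝ) :
    Matrix (Fin n) (Fin n) ℝ →L[ℝ] ℝ :=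
  LinearMap.toContinuousLinearMap
    { toFun := fun H => (S * H).trace
      map_add' := fun H K => by simp [Matrix.mul_add]
      map_smul' := fun c H => by simp [Matrix.mul_smul] }

/-- bounded compactly supported probability densities -/
structure CC {n : ℕ} (ρ : (Fin n → ℝ) → ℝ) : Prop where
  meas : Measurable ρ
  nonneg : ∀ x, 0 ≤ ρ x
  bdd : ∃ C, ∀ x, ρ x ≤ C
  supp : ∃ R : ℝ, ∀ x, R < ‖x‖ → ρ x = 0
  int_one : ∫ x, ρ x = 1

lemma integrable_of_bdd_supp {n : ℕ} {f : (Fin n → ℝ) → ℝ} (hm : Measurable f) (R C : ℝ)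
    (hC : ∀ x, ‖x‖ ≤ R → |f x| ≤ C) (hs : ∀ x, R < ‖x‖ → f x = 0) : Integrable f := by
  have h1 : IntegrableOn f (Metric.closedBall 0 R) := by
    refine Measure.integrableOn_of_bounded (M := C) ?_ hm.aestronglyMeasurable ?_
    · exact measure_closedBall_lt_top.ne
    · filter_upwards [ae_restrict_mem measurableSet_closedBall] with x hx
      exact hC x (by simpa using hx)
  rw [← integrableOn_iff_integrable_of_support_subset (s := Metric.closedBall 0 R)]
  · exact h1
  · intro x hx
    by_contra h
    exact hx (hs x (by simpa using h))

lemma CC.integrable_mul {n : ℕ} {ρ : (Fin n → ℝ) → ℝ} (h : CC ρ) {f : (Fin n → ℝ) → ℝ}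
    (hf : Continuous f) : Integrable fun x => f x * ρ x := by
  obtain ⟨C, hC⟩ := h.bdd
  obtain ⟨R, hR⟩ := h.supp
  obtain ⟨D, hD⟩ := (isCompact_closedBall (0 : Fin n → ℝ) R).exists_bound_of_continuousOn
    hf.continuousOn
  refine integrable_of_bdd_supp (hf.measurable.mul h.meas) R (D * C) ?_ ?_
  · intro x hx
    rw [abs_mul, abs_of_nonneg (h.nonneg x)]
    have h1 := hD x (by simpa using hx)
    exact mul_le_mul h1 (hC x) (h.nonneg x) ((norm_nonneg _).trans h1)
  · intro x hx
    simp [hR x hx]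

lemma CC.integrable {n : ℕ} {ρ : (Fin n → ℝ) → ℝ} (h : CC ρ) : Integrable ρ := by
  simpa using h.integrable_mul (f := fun _ => 1) continuous_const

lemma CC.integrable_log {n : ℕ} {ρ : (Fin n → ℝ) → ℝ} (h : CC ρ) :
    Integrable fun x => ρ x * Real.log (ρ x) := by
  obtain ⟨C, hC⟩ := h.bdd
  obtain ⟨R, hR⟩ := h.supp
  obtain ⟨D, hD⟩ := (isCompact_Icc (a := (0:ℝ)) (b := C)).exists_bound_of_continuousOn
    Real.continuous_mul_log.continuousOn
  refine integrable_of_bdd_supp (h.meas.mul (Real.measurable_log.comp h.meas)) R D ?_ ?_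
  · intro x hx
    exact hD (ρ x) ⟨h.nonneg x, hC x⟩
  · intro x hx
    simp [hR x hx]

lemma CC.good {n : ℕ} {ρ : (Fin n → ℝ) → ℝ} (h : CC ρ) : IsGoodDensity ρ :=
  ⟨h.meas, h.nonneg, h.int_one, fun i j => h.integrable_mul (by fun_prop), h.integrable_log⟩

/-- quadratic form -/
def qf {n : ℕ} (A : Matrix (Fin n) (Fin n) ℝ) (x : Fin n → ℝ) : ℝ := x ⬝ᵥ A *ᵥ x

/-- entrywise pairing -/
def pr {n : ℕ} (A M : Matrix (Fin n) (Fin n) ℝ) : ℝ := ∑ i, ∑ j, A i j * M i j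

lemma qf_eq {n : ℕ} (A : Matrix (Fin n) (Fin n) ℝ) (x : Fin n → ℝ) :
    qf A x = ∑ i, ∑ j, A i j * (x i * x j) := by
  unfold qf dotProduct mulVec dotProduct
  refine Finset.sum_congr rfl fun i _ => ?_
  rw [Finset.mul_sum]
  exact Finset.sum_congr rfl fun j _ => by ring

lemma continuous_qf {n : ℕ} (A : Matrix (Fin n) (Fin n) ℝ) : Continuous (qf A) := by
  have : qf A = fun x => ∑ i, ∑ j, A i j * (x i * x j) := funext (qf_eq A)
  rw [this]; fun_prop

lemma good_qf {n : ℕ} {ρ : (Fin n → ℝ) → ℝ} (h : IsGoodDensity ρ)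
    (A : Matrix (Fin n) (Fin n) ℝ) :
    Integrable (fun x => qf A x * ρ x) ∧ ∫ x, qf A x * ρ x = pr A (momMatrix ρ) := by
  have e : (fun x => qf A x * ρ x) = fun x => ∑ i, ∑ j, A i j * (x i * x j * ρ x) := by
    funext x
    rw [qf_eq, Finset.sum_mul]
    refine Finset.sum_congr rfl fun i _ => ?_
    rw [Finset.sum_mul]
    exact Finset.sum_congr rfl fun j _ => by ring
  have hi : ∀ i j, Integrable fun x : Fin n → ℝ => A i j * (x i * x j * ρ x) :=
    fun i j => (h.2.2.2.1 i j).const_mul _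
  rw [e]
  refine ⟨integrable_finsetSum _ fun i _ => integrable_finsetSum _ fun j _ => hi i j, ?_⟩
  rw [integral_finsetSum _ fun i _ => integrable_finsetSum _ fun j _ => hi i j]
  unfold pr
  refine Finset.sum_congr rfl fun i _ => ?_
  rw [integral_finsetSum _ fun j _ => hi i j]
  refine Finset.sum_congr rfl fun j _ => ?_
  rw [integral_const_mul]; rfl

/-- Gibbs variational inequality -/
lemma gibbs {n : ℕ} {ρ h : (Fin n → ℝ) → ℝ} (hρ : IsGoodDensity ρ)
    (hi : Integrable fun x => h x * ρ x) (hZ : Integrable fun x => Real.exp (-h x)) :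
    entropy ρ - ∫ x, h x * ρ x ≤ Real.log (∫ x, Real.exp (-h x)) := by
  obtain ⟨hm, h0, h1, h2, h3⟩ := hρ
  have hρi : Integrable ρ := by
    by_contra hc
    rw [integral_undef hc] at h1
    exact zero_ne_one h1
  set Z := ∫ x, Real.exp (-h x) with hZdef
  have hZpos : 0 < Z := integral_exp_pos hZ
  have key : ∀ x, -(ρ x * Real.log (ρ x)) - h x * ρ x ≤
      Real.exp (-h x) / Z - ρ x + ρ x * Real.log Z := by
    intro x
    rcases (h0 x).eq_or_lt with he | hlt
    · rw [← he]; simp; positivity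
    · have ht : 0 < Real.exp (-h x) / (Z * ρ x) := by positivity
      have hl := Real.log_le_sub_one_of_pos ht
      rw [Real.log_div (by positivity) (by positivity), Real.log_exp,
        Real.log_mul hZpos.ne' hlt.ne'] at hl
      have := mul_le_mul_of_nonneg_left hl hlt.le
      have e : ρ x * (Real.exp (-h x) / (Z * ρ x) - 1) = Real.exp (-h x) / Z - ρ x := by
        field_simp
      rw [e] at this
      linarith
  have h3' : Integrable fun x => -(ρ x * Real.log (ρ x)) := h3.neg
  have h4 : Integrable fun x => Real.exp (-h x) / Z - ρ x := (hZ.div_const Z).sub hρi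
  have hI := integral_mono (f := fun x => -(ρ x * Real.log (ρ x)) - h x * ρ x)
    (g := fun x => Real.exp (-h x) / Z - ρ x + ρ x * Real.log Z)
    (h3'.sub hi) (h4.add (hρi.mul_const _)) key
  rw [integral_sub h3' hi, integral_add h4 (hρi.mul_const _),
    integral_sub (hZ.div_const Z) hρi, integral_div, integral_mul_const, h1, ← hZdef,
    div_self hZpos.ne', integral_neg] at hI
  unfold entropy
  linarith

/-- pushforward density -/
def push {n : ℕ} (L : Matrix (Fin n) (Fin n) ℝ) (ρ : (Fin n → ℝ) → ℝ) : (Fin n → ℝ) → ℝ :=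
  fun x => |L.det|⁻¹ * ρ (L⁻¹ *ᵥ x)

lemma cov_integral {n : ℕ} {L : Matrix (Fin n) (Fin n) ℝ} (hL : L.det ≠ 0)
    (f : (Fin n → ℝ) → ℝ) : ∫ x, f (L *ᵥ x) = |L.det|⁻¹ * ∫ x, f x := by
  have hme : MeasurableEmbedding (toLin' L) := by
    have : LinearMap.ker (toLin' L) = ⊥ := by
      rw [LinearMap.ker_eq_bot]
      have hu : IsUnit L := by rw [Matrix.isUnit_iff_isUnit_det]; exact hL.isUnit
      intro a b hab
      simp only [toLin'_apply] at hab
      exact Matrix.mulVec_injective_iff_isUnit.mpr hu hab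
    exact ((LinearMap.isClosedEmbedding_of_injective this)).measurableEmbedding
  have h := hme.integral_map (μ := volume) f
  rw [Real.map_matrix_volume_pi_eq_smul_volume_pi hL, integral_smul_measure] at h
  simp only [toLin'_apply] at h
  rw [← h, ENNReal.toReal_ofReal (abs_nonneg _), abs_inv, smul_eq_mul]

lemma push_integral {n : ℕ} {L : Matrix (Fin n) (Fin n) ℝ} (hL : L.det ≠ 0)
    (ρ : (Fin n → ℝ) → ℝ) (g : (Fin n → ℝ) → ℝ → ℝ) :
    ∫ x, g x (ρ (L⁻¹ *ᵥ x)) = |L.det| * ∫ x, g (L *ᵥ x) (ρ x) := by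
  have := cov_integral hL (fun x => g x (ρ (L⁻¹ *ᵥ x)))
  have hu : IsUnit L.det := hL.isUnit
  simp only [mulVec_mulVec, nonsing_inv_mul _ hu, one_mulVec] at this
  rw [this, ← mul_assoc, mul_inv_cancel₀ (abs_ne_zero.mpr hL), one_mul]

lemma push_integral_mul {n : ℕ} {L : Matrix (Fin n) (Fin n) ℝ} (hL : L.det ≠ 0)
    (ρ : (Fin n → ℝ) → ℝ) (g : (Fin n → ℝ) → ℝ) :
    ∫ x, g x * push L ρ x = ∫ x, g (L *ᵥ x) * ρ x := by
  unfold push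
  rw [push_integral hL ρ (fun x t => g x * (|L.det|⁻¹ * t)), ← integral_const_mul]
  congr 1; funext x
  have := abs_ne_zero.mpr hL
  field_simp

lemma push_CC {n : ℕ} {L : Matrix (Fin n) (Fin n) ℝ} (hL : L.det ≠ 0)
    {ρ : (Fin n → ℝ) → ℝ} (h : CC ρ) : CC (push L ρ) := by
  have hu : IsUnit L.det := hL.isUnit
  refine ⟨?_, ?_, ?_, ?_, ?_⟩
  · have hc : Continuous fun x : Fin n → ℝ => L⁻¹ *ᵥ x := by fun_prop
    exact (h.meas.comp hc.measurable).const_mul _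
  · intro x
    exact mul_nonneg (by positivity) (h.nonneg _)
  · obtain ⟨C, hC⟩ := h.bdd
    exact ⟨|L.det|⁻¹ * C, fun x => mul_le_mul_of_nonneg_left (hC _) (by positivity)⟩
  · obtain ⟨R, hR⟩ := h.supp
    have hc : Continuous fun x : Fin n → ℝ => L *ᵥ x := by fun_prop
    obtain ⟨D, hD⟩ := (isCompact_closedBall (0 : Fin n → ℝ) R).exists_bound_of_continuousOn
      hc.continuousOn
    refine ⟨D, fun x hx => ?_⟩
    have : ρ (L⁻¹ *ᵥ x) = 0 := by
      apply hR
      by_contra hcon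
      have := hD (L⁻¹ *ᵥ x) (by simpa using hcon)
      simp only [mulVec_mulVec, mul_nonsing_inv _ hu, one_mulVec] at this
      linarith
    simp [push, this]
  · have := push_integral_mul hL ρ (fun _ => 1)
    simpa [h.int_one] using this

lemma push_entropy {n : ℕ} {L : Matrix (Fin n) (Fin n) ℝ} (hL : L.det ≠ 0)
    {ρ : (Fin n → ℝ) → ℝ} (h : CC ρ) : entropy (push L ρ) = entropy ρ + Real.log |L.det| := by
  unfold entropy push
  rw [push_integral hL ρ (fun x t => |L.det|⁻¹ * t * Real.log (|L.det|⁻¹ * t)),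
    ← integral_const_mul]
  have hd := abs_pos.mpr hL
  have : ∀ x, |L.det| * (|L.det|⁻¹ * ρ x * Real.log (|L.det|⁻¹ * ρ x)) =
      ρ x * Real.log (ρ x) - Real.log |L.det| * ρ x := by
    intro x
    rcases (h.nonneg x).eq_or_lt with he | hlt
    · simp [← he]
    · rw [Real.log_mul (by positivity) hlt.ne', Real.log_inv]
      field_simp
      ring
  simp only [this]
  rw [integral_sub h.integrable_log (h.integrable.const_mul _), integral_const_mul, h.int_one]
  ring

lemma push_mom {n : ℕ} {L : Matrix (Fin n) (Fin n) ℝ} (hL : L.det ≠ 0)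
    {ρ : (Fin n → ℝ) → ℝ} (h : CC ρ) : momMatrix (push L ρ) = L * momMatrix ρ * Lᵀ := by
  ext i j
  simp only [momMatrix, of_apply]
  rw [push_integral_mul hL ρ (fun x => x i * x j)]
  have e : ∀ x : Fin n → ℝ, (L *ᵥ x) i * (L *ᵥ x) j * ρ x =
      ∑ k, ∑ l, L i l * L j k * (x l * x k * ρ x) := by
    intro x
    simp only [mulVec, dotProduct]
    rw [mul_comm (∑ _, _), Finset.sum_mul_sum, Finset.sum_mul]
    refine Finset.sum_congr rfl fun k _ => ?_
    rw [Finset.sum_mul]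
    exact Finset.sum_congr rfl fun l _ => by ring
  have hi : ∀ k l, Integrable fun x : Fin n → ℝ => L i l * L j k * (x l * x k * ρ x) :=
    fun k l => (h.good.2.2.2.1 l k).const_mul _
  simp only [e]
  rw [integral_finsetSum _ fun i _ => integrable_finsetSum _ fun j _ => hi i j]
  simp only [mul_apply, transpose_apply, of_apply]
  refine Finset.sum_congr rfl fun k _ => ?_
  rw [integral_finsetSum _ fun l _ => hi k l, Finset.sum_mul]
  refine Finset.sum_congr rfl fun l _ => ?_
  rw [integral_const_mul]; ring


/-- the base one-dimensional density -/
def u1 : ℝ → ℝ := Set.indicator (Set.Icc (-√3) (√3)) (fun _ => (2 * √3)⁻¹)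

lemma u1_int (g : ℝ → ℝ) : ∫ t, g t * u1 t = (2 * √3)⁻¹ * ∫ t in (-√3)..(√3), g t := by
  have : (fun t => g t * u1 t) =
      Set.indicator (Set.Icc (-√3) (√3)) (fun t => (2 * √3)⁻¹ * g t) := by
    funext t
    by_cases h : t ∈ Set.Icc (-√3) (√3)
    · simp only [u1, Set.indicator_of_mem h]; ring
    · simp only [u1, Set.indicator_of_notMem h]; ring
  rw [this, integral_indicator measurableSet_Icc, integral_const_mul, integral_Icc_eq_integral_Ioc,
    intervalIntegral.integral_of_le (by linarith [Real.sqrt_nonneg 3])]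

lemma u1_zero : ∫ t, u1 t = 1 := by
  have := u1_int (fun _ => 1)
  simp only [one_mul, intervalIntegral.integral_const, smul_eq_mul, mul_one] at this
  rw [this]
  have : (√3 : ℝ) ≠ 0 := by positivity
  field_simp; ring

lemma u1_one : ∫ t, t * u1 t = 0 := by
  rw [u1_int (fun t => t), integral_id]; simp

lemma u1_two : ∫ t, t * t * u1 t = 1 := by
  rw [u1_int (fun t => t * t)]
  simp only [← pow_two]
  rw [integral_pow]
  have h0 : (√3 : ℝ) ≠ 0 := by positivity
  have h : (√3 : ℝ) ^ 2 = 3 := Real.sq_sqrt (by norm_num)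
  have h3 : (√3 : ℝ) ^ 3 = 3 * √3 := by rw [pow_succ, h]
  have h4 : (-√3 : ℝ) ^ 3 = - (3 * √3) := by rw [Odd.neg_pow (by decide), h3]
  norm_num [h3, h4]
  field_simp; norm_num

/-- the base density -/
def cube (n : ℕ) : (Fin n → ℝ) → ℝ := fun x => ∏ i, u1 (x i)

lemma cube_CC (n : ℕ) : CC (cube n) := by
  have hn : ∀ t, 0 ≤ u1 t := fun t => Set.indicator_nonneg (fun _ _ => by positivity) t
  have hm : Measurable u1 := measurable_const.indicator measurableSet_Icc
  refine ⟨?_, ?_, ?_, ?_, ?_⟩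
  · exact Finset.measurable_fun_prod _ fun i _ => hm.comp (measurable_pi_apply i)
  · exact fun x => Finset.prod_nonneg fun i _ => hn _
  · refine ⟨∏ i : Fin n, (2 * √3)⁻¹, fun x => Finset.prod_le_prod (fun i _ => hn _) fun i _ => ?_⟩
    exact Set.indicator_le_self' (fun _ _ => by positivity) _
  · refine ⟨√3, fun x hx => ?_⟩
    by_contra hc
    have : ‖x‖ ≤ √3 := by
      rw [pi_norm_le_iff_of_nonneg (by positivity)]
      intro i
      have hi : u1 (x i) ≠ 0 := fun h => hc (Finset.prod_eq_zero (Finset.mem_univ i) h)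
      have := Set.mem_of_indicator_ne_zero hi
      exact abs_le.mpr this
    linarith
  · unfold cube
    rw [integral_fintype_prod_volume_eq_prod (fun _ => u1)]
    simp [u1_zero]

lemma cube_mom (n : ℕ) : momMatrix (cube n) = 1 := by
  ext i j
  simp only [momMatrix, of_apply]
  have e : ∀ x : Fin n → ℝ, x i * x j * cube n x =
      ∏ k, ((if k = i then x k else 1) * (if k = j then x k else 1) * u1 (x k)) := by
    intro x
    rw [Finset.prod_mul_distrib, Finset.prod_mul_distrib]
    simp [cube]
  simp only [e]
  rw [integral_fintype_prod_volume_eq_prod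
    (fun k t => (if k = i then t else 1) * (if k = j then t else 1) * u1 t)]
  by_cases hij : i = j
  · subst hij
    rw [Matrix.one_apply_eq]
    refine Finset.prod_eq_one fun k _ => ?_
    by_cases h : k = i
    · simp [h, u1_two]
    · simp [h, u1_zero]
  · rw [Matrix.one_apply_ne hij]
    refine Finset.prod_eq_zero (Finset.mem_univ i) ?_
    simp [hij, u1_one]

/-- value functional -/
def vv {n : ℕ} (U : (Fin n → ℝ) → ℝ) (B : Matrix (Fin n) (Fin n) ℝ) (ρ : (Fin n → ℝ) → ℝ) : ℝ :=
  entropy ρ - ∫ x, U (B *ᵥ x) * ρ x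

/-- the reduced functional -/
def Psi {n : ℕ} (U : (Fin n → ℝ) → ℝ) (B : Matrix (Fin n) (Fin n) ℝ) : ℝ :=
  sSup {r | ∃ ρ, CC ρ ∧ momMatrix ρ = 1 ∧ r = vv U B ρ}

lemma dot_self_le {n : ℕ} (x : Fin n → ℝ) : x ⬝ᵥ x ≤ n * ‖x‖ ^ 2 := by
  unfold dotProduct
  calc ∑ i, x i * x i ≤ ∑ i : Fin n, ‖x‖ ^ 2 := by
        refine Finset.sum_le_sum fun i _ => ?_
        have := norm_le_pi_norm x i
        rw [← pow_two, ← sq_abs]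
        exact pow_le_pow_left₀ (abs_nonneg _) this 2
    _ = _ := by simp

lemma U_lower {n : ℕ} {U : (Fin n → ℝ) → ℝ} (hU : SuperQuadratic U) (c : ℝ) (hc : 0 ≤ c) :
    ∃ b, ∀ x, c * (x ⬝ᵥ x) - b ≤ U x := by
  have h := hU.2 (c * n + 1) (by positivity)
  have hcont : Continuous (fun x : Fin n → ℝ => U x - (c * n + 1) * ‖x‖ ^ 2) := by
    have := hU.1
    fun_prop
  obtain ⟨x0, hx0⟩ := hcont.exists_forall_le h
  refine ⟨-(U x0 - (c * n + 1) * ‖x0‖ ^ 2), fun x => ?_⟩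
  have h1 := hx0 x
  have h2 := mul_le_mul_of_nonneg_left (dot_self_le x) hc
  have h3 := sq_nonneg ‖x‖
  nlinarith

lemma gauss_int {n : ℕ} {l : ℝ} (hl : 0 < l) (b : ℝ) :
    Integrable fun x : Fin n → ℝ => Real.exp (b - l * (x ⬝ᵥ x)) := by
  have h := Integrable.fintype_prod (ι := Fin n) (μ := fun _ => (volume : Measure ℝ))
    (f := fun _ t => Real.exp (-l * t ^ 2)) (fun _ => integrable_exp_neg_mul_sq hl)
  have h2 := h.const_mul (Real.exp b)
  refine h2.congr (ae_of_all _ fun x => ?_)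
  simp only
  rw [← Real.exp_sum, ← Real.exp_add]
  congr 1
  simp only [dotProduct, Finset.mul_sum, sub_eq_add_neg, ← Finset.sum_neg_distrib]
  congr 1
  exact Finset.sum_congr rfl fun i _ => by ring

/-- the exponent -/
def hh {n : ℕ} (U : (Fin n → ℝ) → ℝ) (A B : Matrix (Fin n) (Fin n) ℝ) (x : Fin n → ℝ) : ℝ :=
  U (B *ᵥ x) + 1 / 2 * qf A x

lemma hh_cont {n : ℕ} {U : (Fin n → ℝ) → ℝ} (hU : SuperQuadratic U)
    (A B : Matrix (Fin n) (Fin n) ℝ) : Continuous (hh U A B) := by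
  have := hU.1
  have h2 := continuous_qf A
  have h3 : Continuous fun x : Fin n → ℝ => B *ᵥ x := by fun_prop
  unfold hh
  exact (this.comp h3).add (continuous_const.mul h2)

lemma U_cont {n : ℕ} {U : (Fin n → ℝ) → ℝ} (hU : SuperQuadratic U)
    (B : Matrix (Fin n) (Fin n) ℝ) : Continuous fun x => U (B *ᵥ x) :=
  hU.1.comp (by fun_prop)

lemma exp_hh_int {n : ℕ} {U : (Fin n → ℝ) → ℝ} (hU : SuperQuadratic U)
    {A B : Matrix (Fin n) (Fin n) ℝ} {c l : ℝ} (hc : 0 ≤ c) (hl : 0 < l)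
    (h : ∀ x, l * (x ⬝ᵥ x) ≤ 1 / 2 * qf A x + c * ((B *ᵥ x) ⬝ᵥ (B *ᵥ x))) :
    Integrable fun x => Real.exp (-hh U A B x) := by
  obtain ⟨b, hb⟩ := U_lower hU c hc
  refine (gauss_int (n := n) hl b).mono' ?_ (ae_of_all _ fun x => ?_)
  · exact (Real.continuous_exp.comp (hh_cont hU A B).neg).aestronglyMeasurable
  · rw [Real.norm_eq_abs, abs_of_pos (Real.exp_pos _)]
    apply Real.exp_le_exp.mpr
    have := h x
    have := hb (B *ᵥ x)
    unfold hh
    linarith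

lemma weak_dual {n : ℕ} {U : (Fin n → ℝ) → ℝ} (hU : SuperQuadratic U)
    {A B : Matrix (Fin n) (Fin n) ℝ} (hZ : Integrable fun x => Real.exp (-hh U A B x))
    {ρ : (Fin n → ℝ) → ℝ} (hρ : CC ρ) :
    vv U B ρ - 1 / 2 * pr A (momMatrix ρ) ≤ Real.log (∫ x, Real.exp (-hh U A B x)) := by
  have h1 : Integrable fun x => U (B *ᵥ x) * ρ x := hρ.integrable_mul (U_cont hU B)
  obtain ⟨h2, h3⟩ := good_qf hρ.good A
  have h4 : (fun x => hh U A B x * ρ x) =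
      fun x => U (B *ᵥ x) * ρ x + 1 / 2 * (qf A x * ρ x) := by
    funext x; unfold hh; ring
  have h5 := gibbs (h := hh U A B) hρ.good (by rw [h4]; exact h1.add (h2.const_mul _)) hZ
  rw [h4, integral_add h1 (h2.const_mul _), integral_const_mul, h3] at h5
  unfold vv
  linarith

lemma Psi_bdd {n : ℕ} {U : (Fin n → ℝ) → ℝ} (hU : SuperQuadratic U)
    (B : Matrix (Fin n) (Fin n) ℝ) :
    BddAbove {r | ∃ ρ, CC ρ ∧ momMatrix ρ = 1 ∧ r = vv U B ρ} := by
  have hZ : Integrable fun x => Real.exp (-hh U 1 B x) := by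
    refine exp_hh_int hU (c := 0) (l := 1 / 2) le_rfl (by norm_num) fun x => ?_
    simp [qf]
  refine ⟨Real.log (∫ x, Real.exp (-hh U 1 B x)) + 1 / 2 * pr (1 : Matrix (Fin n) (Fin n) ℝ) 1, ?_⟩
  rintro r ⟨ρ, hρ, hm, rfl⟩
  have := weak_dual hU hZ hρ
  rw [hm] at this
  linarith

lemma Psi_le {n : ℕ} {U : (Fin n → ℝ) → ℝ} (hU : SuperQuadratic U)
    {A B : Matrix (Fin n) (Fin n) ℝ} (hZ : Integrable fun x => Real.exp (-hh U A B x)) :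
    Psi U B ≤ Real.log (∫ x, Real.exp (-hh U A B x)) + 1 / 2 * pr A 1 := by
  refine csSup_le ⟨_, cube n, cube_CC n, cube_mom n, rfl⟩ ?_
  rintro r ⟨ρ, hρ, hm, rfl⟩
  have := weak_dual hU hZ hρ
  rw [hm] at this
  linarith

lemma le_Psi {n : ℕ} {U : (Fin n → ℝ) → ℝ} (hU : SuperQuadratic U)
    (B : Matrix (Fin n) (Fin n) ℝ) {ρ : (Fin n → ℝ) → ℝ} (hρ : CC ρ) (hm : momMatrix ρ = 1) :
    vv U B ρ ≤ Psi U B := le_csSup (Psi_bdd hU B) ⟨ρ, hρ, hm, rfl⟩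


open scoped MatrixOrder in
lemma exists_msqrt {n : ℕ} (G : Matrix (Fin n) (Fin n) ℝ) (hG : G.PosSemidef) :
    ∃ S : Matrix (Fin n) (Fin n) ℝ, S.PosSemidef ∧ S * S = G ∧
      ∀ T : Matrix (Fin n) (Fin n) ℝ, T.PosSemidef → T * T = G → T = S := by
  refine ⟨CFC.sqrt G, (CFC.sqrt_nonneg G).posSemidef, CFC.sqrt_mul_sqrt_self G hG.nonneg, ?_⟩
  intro T hT h
  exact (CFC.sqrt_unique h hT.nonneg).symm

lemma psd_transpose {n : ℕ} {S : Matrix (Fin n) (Fin n) ℝ} (h : S.PosSemidef) : Sᵀ = S := by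
  have := h.1.eq
  rwa [conjTranspose_eq_transpose_of_trivial] at this

lemma entry_le {n : ℕ} {L H : Matrix (Fin n) (Fin n) ℝ} (h : L * Lᵀ = H) {c : ℝ}
    (hc : ∀ i, H i i ≤ c ^ 2) (hc0 : 0 ≤ c) : ‖L‖ ≤ c := by
  rw [Matrix.norm_le_iff hc0]
  intro i j
  have h1 : H i i = ∑ k, L i k * L i k := by rw [← h]; simp [mul_apply]
  have h2 : L i j * L i j ≤ ∑ k, L i k * L i k :=
    Finset.single_le_sum (f := fun k => L i k * L i k) (fun k _ => mul_self_nonneg _)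
      (Finset.mem_univ j)
  rw [Real.norm_eq_abs]
  apply abs_le_of_sq_le_sq _ hc0
  rw [pow_two]
  linarith [hc i]

lemma CC.mix {n : ℕ} {ρ σ : (Fin n → ℝ) → ℝ} (h : CC ρ) (k : CC σ) {a b : ℝ} (ha : 0 ≤ a)
    (hb : 0 ≤ b) (hab : a + b = 1) : CC (fun x => a * ρ x + b * σ x) := by
  refine ⟨(h.meas.const_mul a).add (k.meas.const_mul b), fun x => ?_, ?_, ?_, ?_⟩
  · have := h.nonneg x; have := k.nonneg x; positivity
  · obtain ⟨C, hC⟩ := h.bdd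
    obtain ⟨D, hD⟩ := k.bdd
    exact ⟨a * C + b * D, fun x => add_le_add (mul_le_mul_of_nonneg_left (hC x) ha)
      (mul_le_mul_of_nonneg_left (hD x) hb)⟩
  · obtain ⟨C, hC⟩ := h.supp
    obtain ⟨D, hD⟩ := k.supp
    refine ⟨max C D, fun x hx => ?_⟩
    rw [hC x ((le_max_left _ _).trans_lt hx), hD x ((le_max_right _ _).trans_lt hx)]
    simp
  · rw [integral_add (h.integrable.const_mul a) (k.integrable.const_mul b), integral_const_mul,
      integral_const_mul, h.int_one, k.int_one]
    linarith

lemma mix_mul {n : ℕ} {ρ σ : (Fin n → ℝ) → ℝ} (h : CC ρ) (k : CC σ) (a b : ℝ)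
    {f : (Fin n → ℝ) → ℝ} (hf : Continuous f) :
    ∫ x, f x * (a * ρ x + b * σ x) = a * (∫ x, f x * ρ x) + b * ∫ x, f x * σ x := by
  rw [← integral_const_mul, ← integral_const_mul,
    ← integral_add ((h.integrable_mul hf).const_mul a) ((k.integrable_mul hf).const_mul b)]
  congr 1; funext x; ring

lemma mix_mom {n : ℕ} {ρ σ : (Fin n → ℝ) → ℝ} (h : CC ρ) (k : CC σ) (a b : ℝ) :
    momMatrix (fun x => a * ρ x + b * σ x) = a • momMatrix ρ + b • momMatrix σ := by
  ext i j
  simp only [momMatrix, of_apply, Matrix.add_apply, Matrix.smul_apply, smul_eq_mul]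
  exact mix_mul h k a b (f := fun x => x i * x j) (by fun_prop)

lemma mix_vv {n : ℕ} {U : (Fin n → ℝ) → ℝ} (hU : SuperQuadratic U)
    (B : Matrix (Fin n) (Fin n) ℝ) {ρ σ : (Fin n → ℝ) → ℝ} (h : CC ρ) (k : CC σ) {a b : ℝ}
    (ha : 0 ≤ a) (hb : 0 ≤ b) (hab : a + b = 1) :
    a * vv U B ρ + b * vv U B σ ≤ vv U B (fun x => a * ρ x + b * σ x) := by
  unfold vv
  rw [mix_mul h k a b (U_cont hU B)]
  have : ∫ x, (a * ρ x + b * σ x) * Real.log (a * ρ x + b * σ x) ≤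
      a * (∫ x, ρ x * Real.log (ρ x)) + b * ∫ x, σ x * Real.log (σ x) := by
    rw [← integral_const_mul, ← integral_const_mul,
      ← integral_add (h.integrable_log.const_mul a) (k.integrable_log.const_mul b)]
    refine integral_mono (h.mix k ha hb hab).integrable_log
      ((h.integrable_log.const_mul a).add (k.integrable_log.const_mul b)) fun x => ?_
    have := Real.convexOn_mul_log.2 (x := ρ x) (h.nonneg x) (y := σ x) (k.nonneg x) ha hb hab
    simpa using this
  unfold entropy
  linarith

lemma push_vv {n : ℕ} {U : (Fin n → ℝ) → ℝ} (B : Matrix (Fin n) (Fin n) ℝ)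
    {L : Matrix (Fin n) (Fin n) ℝ} (hL : L.det ≠ 0) {ρ : (Fin n → ℝ) → ℝ} (h : CC ρ) :
    vv U B (push L ρ) = vv U (B * L) ρ + Real.log |L.det| := by
  unfold vv
  rw [push_entropy hL h, push_integral_mul hL ρ (fun x => U (B *ᵥ x))]
  simp only [mulVec_mulVec]
  ring

lemma qf_smul {n : ℕ} (A : Matrix (Fin n) (Fin n) ℝ) (c : ℝ) (x : Fin n → ℝ) :
    qf A (c • x) = c ^ 2 * qf A x := by
  simp [qf, mulVec_smul]; ring

lemma qf_transpose {n : ℕ} (A : Matrix (Fin n) (Fin n) ℝ) (x : Fin n → ℝ) :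
    qf Aᵀ x = qf A x := by
  unfold qf
  rw [dotProduct_mulVec, vecMul_transpose, dotProduct_comm]

lemma continuous_qf2 {n : ℕ} :
    Continuous (fun p : Matrix (Fin n) (Fin n) ℝ × (Fin n → ℝ) => qf p.1 p.2) := by
  unfold qf
  fun_prop

/-- the sphere in the sup norm suffices for homogeneous inequalities -/
lemma sphere_scale {n : ℕ} {x : Fin n → ℝ} (hx : x ≠ 0) :
    ∃ y ∈ Metric.sphere (0 : Fin n → ℝ) 1, ∃ c : ℝ, 0 < c ∧ x = c • y := by
  have h := norm_pos_iff.mpr hx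
  refine ⟨‖x‖⁻¹ • x, ?_, ‖x‖, h, ?_⟩
  · simp [norm_smul, h.ne']
  · rw [smul_smul, mul_inv_cancel₀ h.ne', one_smul]

lemma nbhd {n : ℕ} {U : (Fin n → ℝ) → ℝ} (hU : SuperQuadratic U)
    (B : Matrix (Fin n) (Fin n) ℝ) :
    ∃ K : ℝ, ∀ᶠ M in 𝓝 (1 : Matrix (Fin n) (Fin n) ℝ),
      ∃ ρ, CC ρ ∧ M + Mᵀ = (2 : ℝ) • momMatrix ρ ∧ K < vv U B ρ := by
  have hpos : ∀ᶠ M in 𝓝 (1 : Matrix (Fin n) (Fin n) ℝ),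
      ∀ x ∈ Metric.sphere (0 : Fin n → ℝ) 1, 0 < qf M x := by
    refine (isCompact_sphere 0 1).eventually_forall_of_forall_eventually
      (P := fun M x => 0 < qf M x) fun x hx => ?_
    apply continuous_qf2.continuousAt.eventually_const_lt
    have : x ≠ 0 := by rintro rfl; simp at hx
    simpa [qf] using Matrix.dotProduct_star_self_pos_iff.mpr this
  have hdet : ∀ᶠ M in 𝓝 (1 : Matrix (Fin n) (Fin n) ℝ),
      1 / 2 < ((1 / 2 : ℝ) • (M + Mᵀ)).det := by
    have hc : Continuous fun M : Matrix (Fin n) (Fin n) ℝ => ((1 / 2 : ℝ) • (M + Mᵀ)).det := by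
      fun_prop
    apply hc.continuousAt.eventually_const_lt
    have : (1 / 2 : ℝ) • ((1 : Matrix (Fin n) (Fin n) ℝ) + 1ᵀ) = 1 := by
      rw [transpose_one, ← two_smul ℝ, smul_smul]; norm_num
    beta_reduce
    rw [this, det_one]; norm_num
  have hdiag : ∀ᶠ M in 𝓝 (1 : Matrix (Fin n) (Fin n) ℝ), ∀ i, M i i < 2 := by
    rw [Filter.eventually_all]
    intro i
    have hc : Continuous fun M : Matrix (Fin n) (Fin n) ℝ => M i i := by fun_prop
    apply hc.continuousAt.eventually_lt_const
    simp
  obtain ⟨R, hR⟩ := (cube_CC n).supp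
  have hcont : Continuous fun p : Matrix (Fin n) (Fin n) ℝ × (Fin n → ℝ) =>
      U ((B * p.1) *ᵥ p.2) := hU.1.comp (by fun_prop)
  obtain ⟨D, hD⟩ := ((isCompact_closedBall (0 : Matrix (Fin n) (Fin n) ℝ) 2).prod
    (isCompact_closedBall (0 : Fin n → ℝ) R)).exists_bound_of_continuousOn hcont.continuousOn
  refine ⟨entropy (cube n) - D + 1 / 2 * Real.log (1 / 2) - 1, ?_⟩
  filter_upwards [hpos, hdet, hdiag] with M h1 h2 h3
  set H := (1 / 2 : ℝ) • (M + Mᵀ) with hH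
  have hHs : H.PosSemidef := by
    refine PosSemidef.of_dotProduct_mulVec_nonneg ?_ fun x => ?_
    · rw [IsHermitian, conjTranspose_eq_transpose_of_trivial, hH, transpose_smul, transpose_add,
        transpose_transpose, add_comm]
    · have e : star x ⬝ᵥ H *ᵥ x = qf M x := by
        have : star x ⬝ᵥ H *ᵥ x = 1 / 2 * (qf M x + qf Mᵀ x) := by
          simp [hH, qf, smul_mulVec, add_mulVec]
          ring
        rw [this, qf_transpose]; ring
      rw [e]
      by_cases hx : x = 0
      · simp [hx, qf]
      · obtain ⟨y, hy, c, hc, rfl⟩ := sphere_scale hx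
        rw [qf_smul]
        have := h1 y hy
        positivity
  obtain ⟨L, hLp, hLL, -⟩ := exists_msqrt H hHs
  have hLt := psd_transpose hLp
  have hLL' : L * Lᵀ = H := by rw [hLt, hLL]
  have hd : L.det * L.det = H.det := by rw [← det_mul, hLL]
  have hdL : L.det ≠ 0 := by
    intro h0
    rw [h0] at hd
    linarith
  refine ⟨push L (cube n), push_CC hdL (cube_CC n), ?_, ?_⟩
  · rw [push_mom hdL (cube_CC n), cube_mom, mul_one, hLL', hH, smul_smul]; norm_num
  · rw [push_vv B hdL (cube_CC n)]
    have hlog : 1 / 2 * Real.log (1 / 2) ≤ Real.log |L.det| := by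
      have h4 : Real.log H.det = 2 * Real.log |L.det| := by
        rw [← hd, ← abs_mul_abs_self, Real.log_mul (by simpa using hdL) (by simpa using hdL)]
        ring
      have := Real.log_le_log (by norm_num) h2.le
      linarith
    have hLn : ‖L‖ ≤ 2 := by
      refine entry_le hLL' (fun i => ?_) (by norm_num)
      have := h3 i
      simp [hH]; linarith
    have hint : ∫ x, U ((B * L) *ᵥ x) * cube n x ≤ D := by
      calc ∫ x, U ((B * L) *ᵥ x) * cube n x ≤ ∫ x, D * cube n x := by
            refine integral_mono ((cube_CC n).integrable_mul (U_cont hU _))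
              ((cube_CC n).integrable.const_mul D) fun x => ?_
            rcases le_or_gt ‖x‖ R with hx | hx
            · refine mul_le_mul_of_nonneg_right ?_ ((cube_CC n).nonneg x)
              exact (le_abs_self _).trans (hD (L, x) ⟨by simpa using hLn, by simpa using hx⟩)
            · simp [hR x hx]
        _ = D := by rw [integral_const_mul, (cube_CC n).int_one, mul_one]
    unfold vv
    linarith


lemma clm_eq {n : ℕ} (f : (Matrix (Fin n) (Fin n) ℝ × ℝ) →L[ℝ] ℝ)
    (M : Matrix (Fin n) (Fin n) ℝ) (r : ℝ) :
    f (M, r) = pr (Matrix.of fun i j => f (Matrix.single i j 1, 0)) M + r * f (0, 1) := by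
  have h1 : (M, r) = (M, 0) + r • ((0 : Matrix (Fin n) (Fin n) ℝ), (1 : ℝ)) := by
    simp
  rw [h1, map_add, map_smul, smul_eq_mul]
  congr 1
  have h2 : ((M, 0) : Matrix (Fin n) (Fin n) ℝ × ℝ) =
      ∑ i, ∑ j, M i j • ((Matrix.single i j 1, 0) : Matrix (Fin n) (Fin n) ℝ × ℝ) := by
    refine Prod.ext ?_ ?_
    · simp only [Prod.fst_sum, Prod.smul_fst, smul_single, smul_eq_mul, mul_one]
      exact Matrix.matrix_eq_sum_single M
    · simp [Prod.snd_sum]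
  rw [h2]
  simp only [map_sum, map_smul, smul_eq_mul, pr, of_apply]
  exact Finset.sum_congr rfl fun i _ => Finset.sum_congr rfl fun j _ => by ring

lemma dual {n : ℕ} {U : (Fin n → ℝ) → ℝ} (hU : SuperQuadratic U)
    (B : Matrix (Fin n) (Fin n) ℝ) :
    ∃ A : Matrix (Fin n) (Fin n) ℝ, ∀ ρ, CC ρ →
      vv U B ρ - 1 / 2 * pr A (momMatrix ρ) ≤ Psi U B - 1 / 2 * pr A 1 := by
  set C : Set (Matrix (Fin n) (Fin n) ℝ × ℝ) :=
    {p | ∃ ρ, CC ρ ∧ p.1 + p.1ᵀ = (2 : ℝ) • momMatrix ρ ∧ p.2 < vv U B ρ} with hC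
  have hconv : Convex ℝ C := by
    rintro ⟨M, r⟩ ⟨ρ, h1, h2, h3⟩ ⟨N, s⟩ ⟨σ, k1, k2, k3⟩ a b ha hb hab
    refine ⟨_, h1.mix k1 ha hb hab, ?_, ?_⟩
    · rw [mix_mom h1 k1]
      simp only [Prod.smul_mk, Prod.mk_add_mk] at *
      rw [smul_add, smul_comm (2 : ℝ) a, smul_comm (2 : ℝ) b, ← h2, ← k2]
      simp only [transpose_add, transpose_smul, smul_add]
      abel
    · refine lt_of_lt_of_le ?_ (mix_vv hU B h1 k1 ha hb hab)
      simp only [Prod.smul_mk, Prod.mk_add_mk, smul_eq_mul] at *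
      rcases ha.eq_or_lt with h0 | h0
      · have : b = 1 := by linarith
        subst this; subst h0; linarith
      · have := mul_lt_mul_of_pos_left h3 h0
        have := mul_le_mul_of_nonneg_left k3.le hb
        linarith
  have hsym : ∀ ρ : (Fin n → ℝ) → ℝ, momMatrix ρ + (momMatrix ρ)ᵀ = (2 : ℝ) • momMatrix ρ := by
    intro ρ
    have : (momMatrix ρ)ᵀ = momMatrix ρ := by
      ext i j
      simp only [momMatrix, transpose_apply, of_apply]
      congr 1; funext x; ring
    rw [this, two_smul]
  have hp : ((1 : Matrix (Fin n) (Fin n) ℝ), Psi U B) ∉ C := by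
    rintro ⟨ρ, h1, h2, h3⟩
    have hm : momMatrix ρ = 1 := by
      rw [transpose_one, ← two_smul ℝ] at h2
      exact (smul_right_injective _ (two_ne_zero (α := ℝ)) h2).symm
    exact absurd h3 (not_lt.mpr (le_Psi hU B h1 hm))
  obtain ⟨K, hK⟩ := nbhd hU B
  have hint : (interior C).Nonempty := by
    refine ⟨(1, K - 1), ?_⟩
    rw [mem_interior_iff_mem_nhds, nhds_prod_eq]
    have hr : ∀ᶠ r in 𝓝 (K - 1), r < K := eventually_lt_nhds (by linarith)
    filter_upwards [hK.prod_mk hr] with p hp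
    obtain ⟨⟨ρ, h1, h2, h3⟩, h4⟩ := hp
    exact ⟨ρ, h1, h2, h4.trans h3⟩
  obtain ⟨f, hf⟩ := geometric_hahn_banach_open_point hconv.interior isOpen_interior
    (fun h => hp (interior_subset h))
  have hf' : ∀ p ∈ C, f p ≤ f (1, Psi U B) := by
    intro p hpC
    have : p ∈ closure (interior C) := by
      rw [hconv.closure_interior_eq_closure_of_nonempty_interior hint]
      exact subset_closure hpC
    have hcl : IsClosed {p | f p ≤ f (1, Psi U B)} := isClosed_le f.continuous continuous_const
    exact closure_minimal (fun q hq => (hf q hq).le) hcl this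
  set k : Matrix (Fin n) (Fin n) ℝ := Matrix.of fun i j => f (Matrix.single i j 1, 0) with hk
  set α := f (0, 1) with hα
  have he : ∀ M r, f (M, r) = pr k M + r * α := clm_eq f
  have hα0 : 0 ≤ α := by
    by_contra hneg
    push Not at hneg
    have h1 : ∀ r < vv U B (cube n), r * α ≤ Psi U B * α := by
      intro r hr
      have := hf' (1, r) ⟨cube n, cube_CC n, by rw [cube_mom, transpose_one, two_smul], hr⟩
      rw [he, he] at this
      linarith
    have h2 := h1 (min (vv U B (cube n)) (Psi U B) - 1)
      (by have := min_le_left (vv U B (cube n)) (Psi U B); linarith)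
    have h3 := min_le_right (vv U B (cube n)) (Psi U B)
    nlinarith
  have hαpos : 0 < α := by
    refine hα0.lt_of_ne fun h0 => ?_
    -- then the linear functional is maximal at the identity
    have h1 : ∀ᶠ M in 𝓝 (1 : Matrix (Fin n) (Fin n) ℝ), pr k M ≤ pr k 1 := by
      filter_upwards [hK] with M hM
      obtain ⟨ρ, h1, h2, h3⟩ := hM
      have := hf' (M, K) ⟨ρ, h1, h2, h3⟩
      rw [he, he, ← h0] at this
      simpa using this
    obtain ⟨q, hq⟩ := hint
    have h2 := hf q hq
    have h3 : f q = pr k q.1 + q.2 * α := clm_eq f q.1 q.2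
    rw [h3, he, ← h0] at h2
    simp only [mul_zero, add_zero] at h2
    have h4 : ∀ t : ℝ, pr k (1 + t • (1 - q.1)) = pr k 1 + t * (pr k 1 - pr k q.1) := by
      intro t
      simp only [pr, Finset.mul_sum, ← Finset.sum_sub_distrib, ← Finset.sum_add_distrib]
      refine Finset.sum_congr rfl fun i _ => Finset.sum_congr rfl fun j _ => ?_
      simp only [Matrix.add_apply, Matrix.smul_apply, Matrix.sub_apply, smul_eq_mul]
      ring
    have h5 : Tendsto (fun t : ℝ => (1 : Matrix (Fin n) (Fin n) ℝ) + t • (1 - q.1)) (𝓝[>] 0)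
        (𝓝 1) := by
      have : Continuous (fun t : ℝ => (1 : Matrix (Fin n) (Fin n) ℝ) + t • (1 - q.1)) := by
        fun_prop
      have := this.tendsto 0
      simp only [zero_smul, add_zero] at this
      exact this.mono_left nhdsWithin_le_nhds
    obtain ⟨t, ht1, ht2⟩ := ((h5.eventually h1).and self_mem_nhdsWithin).exists
    rw [h4] at ht1
    have ht2' : 0 < t := ht2
    nlinarith
  refine ⟨(-2 / α) • k, fun ρ hρ => ?_⟩
  have h1 : ∀ r < vv U B ρ, pr k (momMatrix ρ) + r * α ≤ pr k 1 + Psi U B * α := by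
    intro r hr
    have := hf' (momMatrix ρ, r) ⟨ρ, hρ, hsym ρ, hr⟩
    rwa [he, he] at this
  have h2 : vv U B ρ ≤ (pr k 1 + Psi U B * α - pr k (momMatrix ρ)) / α := by
    refine le_of_forall_lt fun r hr => ?_
    obtain ⟨r', hr1, hr2⟩ := exists_between hr
    refine hr1.trans_le ?_
    rw [le_div_iff₀ hαpos]
    linarith [h1 r' hr2]
  have h3 : ∀ M, pr ((-2 / α) • k) M = -2 / α * pr k M := by
    intro M
    simp only [pr, Finset.mul_sum, Matrix.smul_apply, smul_eq_mul, mul_assoc]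
  rw [h3, h3]
  have h4 : (pr k 1 + Psi U B * α - pr k (momMatrix ρ)) / α =
      Psi U B - 1 / 2 * (-2 / α * pr k 1) + 1 / 2 * (-2 / α * pr k (momMatrix ρ)) := by
    field_simp; ring
  linarith


lemma dual_pos {n : ℕ} {U : (Fin n → ℝ) → ℝ} {A B : Matrix (Fin n) (Fin n) ℝ}
    (hA : ∀ ρ, CC ρ → vv U B ρ - 1 / 2 * pr A (momMatrix ρ) ≤ Psi U B - 1 / 2 * pr A 1)
    {v : Fin n → ℝ} (hv : v ≠ 0) (hBv : B *ᵥ v = 0) : 0 < qf A v := by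
  by_contra hneg
  push Not at hneg
  have hvv : 0 < v ⬝ᵥ v := by simpa using Matrix.dotProduct_star_self_pos_iff.mpr hv
  set d := v ⬝ᵥ v with hd
  -- the stretch map
  have key : ∀ s : ℝ, 1 ≤ s →
      vv U B (cube n) + Real.log s - 1 / 2 * pr A 1 ≤ Psi U B - 1 / 2 * pr A 1 := by
    intro s hs
    set L : Matrix (Fin n) (Fin n) ℝ := 1 + vecMulVec (((s - 1) / d) • v) v with hL
    have hdet : L.det = s := by
      have := det_one_add_replicateCol_mul_replicateRow (ι := Unit) (((s - 1) / d) • v) v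
      rw [← vecMulVec_eq] at this
      rw [hL, this, dotProduct_smul, ← hd, smul_eq_mul]
      field_simp; ring
    have hdet0 : L.det ≠ 0 := by rw [hdet]; linarith
    have hBL : B * L = B := by
      rw [hL, mul_add, mul_one, mul_vecMulVec, mulVec_smul, hBv]
      simp
    have hLL : L * Lᵀ = 1 + ((s ^ 2 - 1) / d) • vecMulVec v v := by
      have : Lᵀ = L := by
        rw [hL, transpose_add, transpose_one, transpose_vecMulVec]
        simp [smul_vecMulVec, vecMulVec_smul]
      rw [this, hL, smul_vecMulVec, mul_add, add_mul, add_mul, one_mul, mul_one, one_mul,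
        smul_mul_assoc, mul_smul_comm, vecMulVec_mul_vecMulVec, ← hd, vecMulVec_smul, smul_smul,
        smul_smul, add_assoc, ← add_smul, ← add_smul]
      congr 2
      field_simp; ring
    have h1 := hA _ (push_CC hdet0 (cube_CC n))
    rw [push_vv B hdet0 (cube_CC n), push_mom hdet0 (cube_CC n), cube_mom, mul_one, hLL, hBL, hdet,
      abs_of_pos (by linarith)] at h1
    have h2 : pr A (1 + ((s ^ 2 - 1) / d) • vecMulVec v v) = pr A 1 + ((s ^ 2 - 1) / d) * qf A v := by
      rw [qf_eq]
      simp only [pr, Finset.mul_sum, ← Finset.sum_add_distrib]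
      refine Finset.sum_congr rfl fun i _ => Finset.sum_congr rfl fun j _ => ?_
      simp only [Matrix.add_apply, Matrix.smul_apply, smul_eq_mul, vecMulVec_apply]
      ring
    rw [h2] at h1
    have h3 : ((s ^ 2 - 1) / d) * qf A v ≤ 0 :=
      mul_nonpos_of_nonneg_of_nonpos (div_nonneg (by nlinarith) hvv.le) hneg
    linarith
  have := key (Real.exp (|Psi U B - vv U B (cube n)| + 1)) (by
    apply Real.one_le_exp; positivity)
  rw [Real.log_exp] at this
  have := le_abs_self (Psi U B - vv U B (cube n))
  linarith

lemma dom {n : ℕ} {A B : Matrix (Fin n) (Fin n) ℝ}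
    (hpos : ∀ v : Fin n → ℝ, v ≠ 0 → B *ᵥ v = 0 → 0 < qf A v) :
    ∃ c l : ℝ, 0 ≤ c ∧ 0 < l ∧ ∀ᶠ B' in 𝓝 B, ∀ x : Fin n → ℝ,
      l * (x ⬝ᵥ x) ≤ 1 / 2 * qf A x + c * ((B' *ᵥ x) ⬝ᵥ (B' *ᵥ x)) := by
  have hnn : ∀ y : Fin n → ℝ, 0 ≤ y ⬝ᵥ y := fun y =>
    Finset.sum_nonneg fun i _ => mul_self_nonneg _
  have hqc := continuous_qf A
  have hne : ∀ x ∈ Metric.sphere (0 : Fin n → ℝ) 1, x ≠ 0 := by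
    rintro x hx rfl; simp at hx
  -- choose c
  obtain ⟨c, hc⟩ := (isCompact_sphere (0 : Fin n → ℝ) 1).elim_directed_cover
    (fun k : ℕ => {x | 0 < 1 / 2 * qf A x + k * ((B *ᵥ x) ⬝ᵥ (B *ᵥ x))})
    (fun k => isOpen_lt continuous_const (by fun_prop)) (by
      intro x hx
      rw [Set.mem_iUnion]
      by_cases h0 : B *ᵥ x = 0
      · refine ⟨0, ?_⟩
        have := hpos x (hne x hx) h0
        simp only [Set.mem_ofPred_eq, h0]
        simpa using this
      · have h1 : 0 < (B *ᵥ x) ⬝ᵥ (B *ᵥ x) := by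
          simpa using Matrix.dotProduct_star_self_pos_iff.mpr h0
        obtain ⟨k, hk⟩ := exists_nat_gt (-(1 / 2 * qf A x) / ((B *ᵥ x) ⬝ᵥ (B *ᵥ x)))
        refine ⟨k, ?_⟩
        rw [div_lt_iff₀ h1] at hk
        simp only [Set.mem_ofPred_eq]
        linarith)
    (by
      refine Monotone.directed_le fun k l hkl x hx => ?_
      simp only [Set.mem_ofPred_eq] at *
      have h1 : (k : ℝ) ≤ l := by exact_mod_cast hkl
      have := mul_le_mul_of_nonneg_right h1 (hnn (B *ᵥ x))
      linarith)
  -- choose l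
  have hcont : Continuous fun x : Fin n → ℝ => 1 / 2 * qf A x + c * ((B *ᵥ x) ⬝ᵥ (B *ᵥ x)) := by
    fun_prop
  obtain ⟨m, hm, hm'⟩ : ∃ m : ℝ, 0 < m ∧ ∀ x ∈ Metric.sphere (0 : Fin n → ℝ) 1,
      m < 1 / 2 * qf A x + c * ((B *ᵥ x) ⬝ᵥ (B *ᵥ x)) := by
    rcases (Metric.sphere (0 : Fin n → ℝ) 1).eq_empty_or_nonempty with he | hne
    · exact ⟨1, one_pos, by simp [he]⟩
    · obtain ⟨x0, hx0, hmin⟩ := (isCompact_sphere (0 : Fin n → ℝ) 1).exists_isMinOn hne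
        hcont.continuousOn
      have h0 := hc hx0
      simp only [Set.mem_ofPred_eq] at h0
      refine ⟨_, half_pos h0, fun x hx => ?_⟩
      have h1 := hmin hx
      simp only [Set.mem_ofPred_eq] at h1
      linarith
  have hev : ∀ᶠ B' in 𝓝 B, ∀ x ∈ Metric.sphere (0 : Fin n → ℝ) 1,
      m < 1 / 2 * qf A x + c * ((B' *ᵥ x) ⬝ᵥ (B' *ᵥ x)) := by
    refine (isCompact_sphere (0 : Fin n → ℝ) 1).eventually_forall_of_forall_eventually
      (P := fun B' x => m < 1 / 2 * qf A x + c * ((B' *ᵥ x) ⬝ᵥ (B' *ᵥ x))) fun x hx => ?_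
    have : Continuous fun p : Matrix (Fin n) (Fin n) ℝ × (Fin n → ℝ) =>
      1 / 2 * qf A p.2 + c * ((p.1 *ᵥ p.2) ⬝ᵥ (p.1 *ᵥ p.2)) := by fun_prop
    exact this.continuousAt.eventually_const_lt (hm' x hx)
  refine ⟨c, m / (n + 1), Nat.cast_nonneg _, by positivity, ?_⟩
  filter_upwards [hev] with B' hB' x
  by_cases hx : x = 0
  · simp [hx, qf]
  · obtain ⟨y, hy, t, ht, rfl⟩ := sphere_scale hx
    have h1 := hB' y hy
    have h2 := dot_self_le y
    have hy1 : ‖y‖ = 1 := by simpa using hy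
    rw [hy1] at h2
    have h3 : m / (n + 1) * (y ⬝ᵥ y) ≤ m := by
      rw [div_mul_eq_mul_div, div_le_iff₀ (by positivity)]
      nlinarith
    rw [qf_smul]
    simp only [mulVec_smul, smul_dotProduct, dotProduct_smul, smul_eq_mul]
    have h4 : 0 < t ^ 2 := by positivity
    nlinarith

/-- strong duality: the Gibbs side is bounded by Psi -/
lemma log_Z_le {n : ℕ} {U : (Fin n → ℝ) → ℝ} (hU : SuperQuadratic U)
    {A B : Matrix (Fin n) (Fin n) ℝ}
    (hA : ∀ ρ, CC ρ → vv U B ρ - 1 / 2 * pr A (momMatrix ρ) ≤ Psi U B - 1 / 2 * pr A 1)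
    (hZ : Integrable fun x => Real.exp (-hh U A B x)) :
    Real.log (∫ x, Real.exp (-hh U A B x)) ≤ Psi U B - 1 / 2 * pr A 1 := by
  have hcov : AECover volume atTop fun k : ℕ => Metric.closedBall (0 : Fin n → ℝ) k :=
    aecover_closedBall tendsto_natCast_atTop_atTop
  have ht := hcov.integral_tendsto_of_countably_generated hZ
  have hZpos := integral_exp_pos hZ
  have ht2 := ht.log hZpos.ne'
  refine le_of_tendsto ht2 ?_
  filter_upwards [ht.eventually_const_lt hZpos] with k hk
  set S := Metric.closedBall (0 : Fin n → ℝ) k with hS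
  set z := ∫ x in S, Real.exp (-hh U A B x) with hz
  have hSm : MeasurableSet S := measurableSet_closedBall
  set ρ : (Fin n → ℝ) → ℝ := S.indicator fun x => z⁻¹ * Real.exp (-hh U A B x) with hρ
  have hec : Continuous fun x => z⁻¹ * Real.exp (-hh U A B x) := by
    have := hh_cont hU A B
    fun_prop
  have hCC : CC ρ := by
    refine ⟨hec.measurable.indicator hSm,
      fun x => Set.indicator_nonneg (fun y _ => by positivity) x, ?_, ?_, ?_⟩
    · obtain ⟨D, hD⟩ := (isCompact_closedBall (0 : Fin n → ℝ) k).exists_bound_of_continuousOn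
        hec.continuousOn
      refine ⟨max D 0, fun x => ?_⟩
      by_cases hx : x ∈ S
      · rw [hρ, Set.indicator_of_mem hx]
        exact ((le_abs_self _).trans (hD x hx)).trans (le_max_left _ _)
      · rw [hρ, Set.indicator_of_notMem hx]
        exact le_max_right _ _
    · refine ⟨k, fun x hx => ?_⟩
      rw [hρ, Set.indicator_of_notMem]
      simpa [hS] using hx
    · rw [hρ, integral_indicator hSm, integral_const_mul, ← hz, inv_mul_cancel₀ hk.ne']
  have h1 := hA ρ hCC
  refine le_trans (le_of_eq ?_) h1
  obtain ⟨h2, h3⟩ := good_qf hCC.good A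
  have h4 : Integrable fun x => U (B *ᵥ x) * ρ x := hCC.integrable_mul (U_cont hU B)
  have h5 : ∀ x, ρ x * Real.log (ρ x) + U (B *ᵥ x) * ρ x + 1 / 2 * (qf A x * ρ x) =
      - Real.log z * ρ x := by
    intro x
    by_cases hx : x ∈ S
    · have : Real.log (ρ x) = - Real.log z - hh U A B x := by
        rw [hρ, Set.indicator_of_mem hx, Real.log_mul (by positivity) (by positivity),
          Real.log_inv, Real.log_exp]
        ring
      rw [this]; unfold hh; ring
    · rw [hρ, Set.indicator_of_notMem hx]; simp
  have h6 : ∫ x, (ρ x * Real.log (ρ x) + U (B *ᵥ x) * ρ x + 1 / 2 * (qf A x * ρ x)) =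
      - Real.log z := by
    simp only [h5]
    rw [integral_const_mul, hCC.int_one, mul_one]
  have h7 : Integrable fun x => ρ x * Real.log (ρ x) + U (B *ᵥ x) * ρ x :=
    hCC.integrable_log.add h4
  rw [integral_add h7 (h2.const_mul _), integral_add hCC.integrable_log h4, integral_const_mul,
    h3] at h6
  unfold vv entropy
  linarith

lemma strong_dual {n : ℕ} {U : (Fin n → ℝ) → ℝ} (hU : SuperQuadratic U)
    (B : Matrix (Fin n) (Fin n) ℝ) :
    ∃ A : Matrix (Fin n) (Fin n) ℝ, ∃ c l : ℝ, 0 ≤ c ∧ 0 < l ∧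
      (∀ᶠ B' in 𝓝 B, ∀ x : Fin n → ℝ,
        l * (x ⬝ᵥ x) ≤ 1 / 2 * qf A x + c * ((B' *ᵥ x) ⬝ᵥ (B' *ᵥ x))) ∧
      Real.log (∫ x, Real.exp (-hh U A B x)) ≤ Psi U B - 1 / 2 * pr A 1 := by
  obtain ⟨A, hA⟩ := dual hU B
  obtain ⟨c, l, hc, hl, hd⟩ := dom (A := A) (B := B) fun v hv hBv => dual_pos hA hv hBv
  exact ⟨A, c, l, hc, hl, hd, log_Z_le hU hA (exp_hh_int hU hc hl hd.self_of_nhds)⟩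

lemma Psi_cont {n : ℕ} {U : (Fin n → ℝ) → ℝ} (hU : SuperQuadratic U) : Continuous (Psi U) := by
  have : FirstCountableTopology (Matrix (Fin n) (Fin n) ℝ) :=
    inferInstanceAs (FirstCountableTopology (Fin n → Fin n → ℝ))
  rw [continuous_iff_continuousAt]
  intro B
  rw [ContinuousAt, tendsto_order]
  constructor
  · intro a ha
    obtain ⟨r, ⟨ρ, h1, h2, rfl⟩, hr⟩ := exists_lt_of_lt_csSup
      (⟨_, cube n, cube_CC n, cube_mom n, rfl⟩ : {r | ∃ ρ, CC ρ ∧ momMatrix ρ = 1 ∧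
        r = vv U B ρ}.Nonempty) ha
    have hc : ContinuousAt (fun B' => vv U B' ρ) B := by
      unfold vv
      refine continuousAt_const.sub ?_
      obtain ⟨R, hR⟩ := h1.supp
      have hcont : Continuous fun p : Matrix (Fin n) (Fin n) ℝ × (Fin n → ℝ) =>
        U (p.1 *ᵥ p.2) := hU.1.comp (by fun_prop)
      obtain ⟨D, hD⟩ := ((isCompact_closedBall B 1).prod
        (isCompact_closedBall (0 : Fin n → ℝ) R)).exists_bound_of_continuousOn hcont.continuousOn
      refine continuousAt_of_dominated (bound := fun x => D * ρ x) ?_ ?_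
        (h1.integrable.const_mul D) ?_
      · exact Eventually.of_forall fun B' =>
          ((U_cont hU B').measurable.mul h1.meas).aestronglyMeasurable
      · filter_upwards [Metric.closedBall_mem_nhds B one_pos] with B' hB'
        refine ae_of_all _ fun x => ?_
        rw [norm_mul, Real.norm_of_nonneg (h1.nonneg x)]
        rcases le_or_gt ‖x‖ R with hx | hx
        · exact mul_le_mul_of_nonneg_right (hD (B', x) ⟨hB', by simpa using hx⟩) (h1.nonneg x)
        · simp [hR x hx]
      · refine ae_of_all _ fun x => ?_
        have : Continuous fun B' : Matrix (Fin n) (Fin n) ℝ => U (B' *ᵥ x) * ρ x :=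
          (hU.1.comp (by fun_prop)).mul continuous_const
        exact this.continuousAt
    filter_upwards [hc.eventually_const_lt hr] with B' hB'
    exact hB'.trans_le (le_Psi hU B' h1 h2)
  · intro a ha
    obtain ⟨A, c, l, hc, hl, hd, hZ⟩ := strong_dual hU B
    obtain ⟨b, hb⟩ := U_lower hU c hc
    have hZc : ContinuousAt (fun B' => ∫ x, Real.exp (-hh U A B' x)) B := by
      refine continuousAt_of_dominated (bound := fun x => Real.exp (b - l * (x ⬝ᵥ x))) ?_ ?_
        (gauss_int hl b) ?_
      · exact Eventually.of_forall fun B' =>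
          (Real.continuous_exp.comp (hh_cont hU A B').neg).aestronglyMeasurable
      · filter_upwards [hd] with B' hB'
        refine ae_of_all _ fun x => ?_
        rw [Real.norm_eq_abs, abs_of_pos (Real.exp_pos _)]
        apply Real.exp_le_exp.mpr
        have := hB' x
        have := hb (B' *ᵥ x)
        unfold hh
        linarith
      · refine ae_of_all _ fun x => ?_
        have h1 : Continuous fun B' : Matrix (Fin n) (Fin n) ℝ => U (B' *ᵥ x) :=
          hU.1.comp (by fun_prop)
        have : Continuous fun B' : Matrix (Fin n) (Fin n) ℝ => Real.exp (-hh U A B' x) := by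
          unfold hh
          exact Real.continuous_exp.comp (h1.add continuous_const).neg
        exact this.continuousAt
    have hpos := integral_exp_pos (exp_hh_int hU hc hl hd.self_of_nhds)
    have hlog := (hZc.log hpos.ne').add_const (1 / 2 * pr A 1)
    have hlt : Real.log (∫ x, Real.exp (-hh U A B x)) + 1 / 2 * pr A 1 < a := by linarith
    filter_upwards [hd, Tendsto.eventually_lt_const hlt hlog] with B' h1 h2
    exact (Psi_le hU (exp_hh_int hU hc hl h1)).trans_lt h2


/-- the positive square root -/
def msq {n : ℕ} (G : Matrix (Fin n) (Fin n) ℝ) : Matrix (Fin n) (Fin n) ℝ :=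
  open Classical in if h : G.PosSemidef then (exists_msqrt G h).choose else 0

lemma msq_spec {n : ℕ} {G : Matrix (Fin n) (Fin n) ℝ} (h : G.PosSemidef) :
    (msq G).PosSemidef ∧ msq G * msq G = G ∧
      ∀ T : Matrix (Fin n) (Fin n) ℝ, T.PosSemidef → T * T = G → T = msq G := by
  have e : msq G = (exists_msqrt G h).choose := by simp [msq, h]
  rw [e]
  exact (exists_msqrt G h).choose_spec

lemma isClosed_psd {n : ℕ} : IsClosed {G : Matrix (Fin n) (Fin n) ℝ | G.PosSemidef} := by
  have : {G : Matrix (Fin n) (Fin n) ℝ | G.PosSemidef} =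
      {G | Gᵀ = G} ∩ ⋂ x : Fin n → ℝ, {G | 0 ≤ qf G x} := by
    ext G
    simp only [Set.mem_inter_iff, Set.mem_iInter, Set.mem_ofPred_eq]
    rw [posSemidef_iff_dotProduct_mulVec, IsHermitian, conjTranspose_eq_transpose_of_trivial]
    simp [qf]
  rw [this]
  refine (isClosed_eq (by fun_prop) continuous_id).inter (isClosed_iInter fun x => ?_)
  refine isClosed_le continuous_const ?_
  unfold qf
  fun_prop

lemma msq_cont {n : ℕ} :
    ContinuousOn (msq (n := n)) {G : Matrix (Fin n) (Fin n) ℝ | G.PosSemidef} := by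
  intro G hG
  have hmem : ∀ᶠ H in 𝓝[{G : Matrix (Fin n) (Fin n) ℝ | G.PosSemidef}] G, H.PosSemidef :=
    eventually_mem_nhdsWithin
  have hdiag : ∀ᶠ H in 𝓝[{G : Matrix (Fin n) (Fin n) ℝ | G.PosSemidef}] G, ‖H‖ < ‖G‖ + 1 :=
    (continuous_norm.continuousAt.eventually_lt_const (by simp)).filter_mono nhdsWithin_le_nhds
  refine (isCompact_closedBall (0 : Matrix (Fin n) (Fin n) ℝ)
    (‖G‖ + 1)).tendsto_nhds_of_unique_mapClusterPt ?_ ?_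
  · filter_upwards [hmem, hdiag] with H h1 h2
    obtain ⟨k1, k2, -⟩ := msq_spec h1
    rw [mem_closedBall_zero_iff]
    refine entry_le (L := msq H) (H := H) (by rw [psd_transpose k1, k2]) (fun i => ?_)
      (by positivity)
    have h3 := Matrix.norm_entry_le_entrywise_sup_norm H (i := i) (j := i)
    have h4 := le_abs_self (H i i)
    rw [Real.norm_eq_abs] at h3
    have := norm_nonneg G
    nlinarith
  · intro T _ hT
    have hTp : T.PosSemidef := by
      change T ∈ {G : Matrix (Fin n) (Fin n) ℝ | G.PosSemidef}
      rw [← isClosed_psd.closure_eq, mem_closure_iff_frequently]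
      rw [mapClusterPt_iff_frequently] at hT
      rw [frequently_iff]
      intro V hV
      obtain ⟨H, h1, h2⟩ := ((hT V hV).and_eventually hmem).exists
      exact ⟨msq H, h1, (msq_spec h2).1⟩
    have hTT : T * T = G := by
      have hsq : Continuous fun S : Matrix (Fin n) (Fin n) ℝ => S * S := by fun_prop
      have h1 : MapClusterPt (T * T) (𝓝[{G : Matrix (Fin n) (Fin n) ℝ | G.PosSemidef}] G)
          ((fun S => S * S) ∘ msq) := hT.continuousAt_comp hsq.continuousAt
      have h2 : Tendsto ((fun S => S * S) ∘ msq)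
          (𝓝[{G : Matrix (Fin n) (Fin n) ℝ | G.PosSemidef}] G) (𝓝 G) := by
        have : Tendsto (fun H : Matrix (Fin n) (Fin n) ℝ => H)
          (𝓝[{G : Matrix (Fin n) (Fin n) ℝ | G.PosSemidef}] G) (𝓝 G) :=
          tendsto_id.mono_left nhdsWithin_le_nhds
        refine this.congr' ?_
        filter_upwards [hmem] with H h
        exact (msq_spec h).2.1.symm
      have h3 : NeBot (𝓝 (T * T) ⊓ 𝓝 G) :=
        NeBot.mono (h1 : NeBot (𝓝 (T * T) ⊓ map _ _)) (inf_le_inf_left _ h2)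
      exact eq_of_nhds_neBot h3
    exact (msq_spec hG).2.2 T hTp hTT

lemma cov_integrable {n : ℕ} {L : Matrix (Fin n) (Fin n) ℝ} (hL : L.det ≠ 0)
    {f : (Fin n → ℝ) → ℝ} (hf : Integrable f) : Integrable fun x => f (L *ᵥ x) := by
  have hme : MeasurableEmbedding (toLin' L) := by
    have : LinearMap.ker (toLin' L) = ⊥ := by
      rw [LinearMap.ker_eq_bot]
      have hu : IsUnit L := by rw [Matrix.isUnit_iff_isUnit_det]; exact hL.isUnit
      intro a b hab
      simp only [toLin'_apply] at hab
      exact Matrix.mulVec_injective_iff_isUnit.mpr hu hab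
    exact ((LinearMap.isClosedEmbedding_of_injective this)).measurableEmbedding
  have h := hme.integrable_map_iff (μ := volume) (g := f)
  rw [Real.map_matrix_volume_pi_eq_smul_volume_pi hL] at h
  have h2 := h.mp (hf.smul_measure ENNReal.ofReal_ne_top)
  exact h2

lemma pr_eq_trace {n : ℕ} (A M : Matrix (Fin n) (Fin n) ℝ) : pr A M = (A * Mᵀ).trace := by
  simp [pr, trace, mul_apply]

lemma Ffun_eq {n : ℕ} {U : (Fin n → ℝ) → ℝ} (hU : SuperQuadratic U)
    {G : Matrix (Fin n) (Fin n) ℝ} (hG : G.PosDef) :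
    2 * Ffun n U G - Real.log G.det = 2 * Psi U (msq G) := by
  obtain ⟨h1, h2, -⟩ := msq_spec hG.posSemidef
  set S := msq G with hS
  have hSt := psd_transpose h1
  have hd : S.det * S.det = G.det := by rw [← det_mul, h2]
  have hdG := hG.det_pos
  have hdS : S.det ≠ 0 := by
    intro h0; rw [h0] at hd; linarith
  have hu : IsUnit S.det := hdS.isUnit
  have hlog : Real.log G.det = 2 * Real.log |S.det| := by
    rw [← hd, ← abs_mul_abs_self, Real.log_mul (by simpa using hdS) (by simpa using hdS)]
    ring
  have hub : ∀ r ∈ { r : ℝ | ∃ ρ : (Fin n → ℝ) → ℝ, IsGoodDensity ρ ∧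
      (Integrable fun x => U x * ρ x) ∧ momMatrix ρ = G ∧ r = entropy ρ - ∫ x, U x * ρ x },
      r ≤ Psi U S + Real.log |S.det| := by
    rintro r ⟨ρ, hρ, hi, hm, rfl⟩
    obtain ⟨A, c, l, hc, hl, hdom, hZ⟩ := strong_dual hU S
    have hZi := exp_hh_int hU hc hl hdom.self_of_nhds
    have hdi : (S⁻¹).det ≠ 0 := by
      rw [det_nonsing_inv, Ring.inverse_eq_inv']; exact inv_ne_zero hdS
    set A' := (S⁻¹)ᵀ * A * S⁻¹ with hA'
    have hq : ∀ x, qf A (S⁻¹ *ᵥ x) = qf A' x := by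
      intro x
      unfold qf
      rw [hA', ← mulVec_mulVec, ← mulVec_mulVec, dotProduct_mulVec x, vecMul_transpose]
    obtain ⟨g1, g2⟩ := good_qf hρ A'
    have e : (fun x => hh U A S (S⁻¹ *ᵥ x) * ρ x) =
        fun x => U x * ρ x + 1 / 2 * (qf A' x * ρ x) := by
      funext x
      unfold hh
      rw [hq, mulVec_mulVec, mul_nonsing_inv _ hu, one_mulVec]
      ring
    have hgib := gibbs (h := fun x => hh U A S (S⁻¹ *ᵥ x)) hρ
      (by rw [e]; exact hi.add (g1.const_mul _)) (cov_integrable hdi hZi)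
    rw [e, integral_add hi (g1.const_mul _), integral_const_mul, g2, hm,
      cov_integral hdi (fun x => Real.exp (-hh U A S x)), Real.log_mul (by simpa using hdi)
      (integral_exp_pos hZi).ne', Real.log_inv, det_nonsing_inv, Ring.inverse_eq_inv', abs_inv,
      Real.log_inv, neg_neg] at hgib
    have hpr : pr A' G = pr A 1 := by
      rw [pr_eq_trace, pr_eq_trace, psd_transpose hG.posSemidef, hA', ← h2, transpose_one, mul_one,
        ← mul_assoc, mul_assoc _ S⁻¹ S, nonsing_inv_mul _ hu, mul_one, mul_assoc, trace_mul_comm,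
        mul_assoc, transpose_nonsing_inv, hSt, mul_nonsing_inv _ hu, mul_one]
    rw [hpr] at hgib
    linarith
  have hle : Ffun n U G ≤ Psi U S + Real.log |S.det| := by
    have hc := cube_CC n
    have hp := push_CC hdS hc
    refine csSup_le ⟨_, push S (cube n), hp.good, hp.integrable_mul hU.1, ?_, rfl⟩ hub
    rw [push_mom hdS hc, cube_mom, mul_one, hSt, h2]
  have hge : Psi U S ≤ Ffun n U G - Real.log |S.det| := by
    refine csSup_le ⟨_, cube n, cube_CC n, cube_mom n, rfl⟩ ?_
    rintro r ⟨ρ, hρ, hm, rfl⟩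
    have hp := push_CC hdS hρ
    have h3 : entropy (push S ρ) - ∫ x, U x * push S ρ x ≤ Ffun n U G := by
      refine le_csSup ⟨_, hub⟩ ⟨push S ρ, hp.good, hp.integrable_mul hU.1, ?_, rfl⟩
      rw [push_mom hdS hρ, hm, mul_one, hSt, h2]
    rw [push_entropy hdS hρ, push_integral_mul hdS ρ U] at h3
    unfold vv
    linarith
  rw [hlog]
  linarith


/-- Continuity of the Luttinger-Ward functional up to the boundary:
`Φ[G] = 2𝓕[G] - Tr[log G] - n log(2πe)`, defined on symmetric positive definite
matrices, extends to a continuous function on the closed cone of symmetric positive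
semidefinite matrices. -/
theorem statement9 (n : ℕ) (hn : 1 ≤ n) (U : (Fin n → ℝ) → ℝ) (hU : SuperQuadratic U) :
    ∃ Φext : Matrix (Fin n) (Fin n) ℝ → ℝ,
      ContinuousOn Φext {G : Matrix (Fin n) (Fin n) ℝ | G.PosSemidef} ∧
      ∀ G : Matrix (Fin n) (Fin n) ℝ, G.PosDef → Φext G = Phi n U G := by
  refine ⟨fun G => 2 * Psi U (msq G) - (n : ℝ) * Real.log (2 * π * Real.exp 1), ?_, fun G hG => ?_⟩
  · exact (continuousOn_const.mul ((Psi_cont hU).comp_continuousOn msq_cont)).sub continuousOn_const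
  · unfold Phi
    simp only [← Ffun_eq hU hG]
end
end

section
/- (Transformation rule for the Luttinger-Ward functional) Let T be an invertible n×n real matrix. Then for every symmetric positive definite n×n matrix G and every interaction U with superquadratic growth, Φ[T G Tᵀ; U] = Φ[G; U ∘ T], where on the right-hand side the interaction is the composition x ↦ U(Tx). -/
open MeasureTheory Matrix Filter Topology Real Asymptotics

attribute [local instance] Matrix.normedAddCommGroup Matrix.normedSpace

noncomputable section

def LWset (n : ℕ) (U : (Fin n → ℝ) → ℝ) (G : Matrix (Fin n) (Fin n) ℝ) : Set ℝ :=
  { r : ℝ | ∃ ρ : (Fin n → ℝ) → ℝ, IsGoodDensity ρ ∧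
    (Integrable fun x => U x * ρ x) ∧ momMatrix ρ = G ∧
    r = entropy ρ - ∫ x, U x * ρ x }

theorem lw_map {n : ℕ} (T : Matrix (Fin n) (Fin n) ℝ) (hT : T.det ≠ 0) :
    ∃ e : (Fin n → ℝ) ≃ᵐ (Fin n → ℝ), (∀ x, e x = T *ᵥ x) ∧
      Measure.map e volume = ENNReal.ofReal (|T.det|⁻¹) • volume := by
  have hu : IsUnit T.det := isUnit_iff_ne_zero.mpr hT
  refine ⟨⟨⟨fun x => T *ᵥ x, fun x => T⁻¹ *ᵥ x, ?_, ?_⟩, ?_, ?_⟩, fun x => rfl, ?_⟩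
  · intro x; simp [Matrix.mulVec_mulVec, Matrix.nonsing_inv_mul _ hu]
  · intro x; simp [Matrix.mulVec_mulVec, Matrix.mul_nonsing_inv _ hu]
  · exact (Continuous.matrix_mulVec continuous_const continuous_id).measurable
  · exact (Continuous.matrix_mulVec continuous_const continuous_id).measurable
  · have := Real.map_matrix_volume_pi_eq_smul_volume_pi hT
    rw [abs_inv] at this
    exact this

theorem lw_integrable {n : ℕ} (T : Matrix (Fin n) (Fin n) ℝ) (hT : T.det ≠ 0)
    (f : (Fin n → ℝ) → ℝ) (h : Integrable fun x => f (T *ᵥ x)) : Integrable f := by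
  obtain ⟨e, he, hm⟩ := lw_map T hT
  have h1 : Integrable f (Measure.map e volume) := by
    rw [integrable_map_equiv]
    have : (f ∘ e) = fun x => f (T *ᵥ x) := by ext x; simp [he]
    rw [this]; exact h
  rw [hm] at h1
  have hp : 0 < |T.det|⁻¹ := by positivity
  exact (integrable_smul_measure (by simpa using hT) ENNReal.ofReal_ne_top).mp h1

theorem lw_integral {n : ℕ} (T : Matrix (Fin n) (Fin n) ℝ) (hT : T.det ≠ 0)
    (f : (Fin n → ℝ) → ℝ) : ∫ y, f y = |T.det| * ∫ x, f (T *ᵥ x) := by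
  obtain ⟨e, he, hm⟩ := lw_map T hT
  have h1 := integral_map_equiv (μ := volume) e f
  rw [hm, integral_smul_measure, ENNReal.toReal_ofReal (by positivity)] at h1
  simp only [he] at h1
  rw [← h1, smul_eq_mul, ← mul_assoc, mul_inv_cancel₀ (by positivity), one_mul]

theorem lw_transform {n : ℕ} (U : (Fin n → ℝ) → ℝ) (T : Matrix (Fin n) (Fin n) ℝ)
    (hT : T.det ≠ 0) (G : Matrix (Fin n) (Fin n) ℝ) (r : ℝ)
    (hr : r ∈ LWset n (fun x => U (T *ᵥ x)) G) :
    r + Real.log |T.det| ∈ LWset n U (T * G * Tᵀ) := by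
  obtain ⟨ρ, ⟨hm, h0, h1, h2, hS⟩, hUi, hG, rfl⟩ := hr
  have hu : IsUnit T.det := isUnit_iff_ne_zero.mpr hT
  set d := |T.det| with hd
  have hdp : 0 < d := by positivity
  have hρi : Integrable ρ := by
    by_contra h
    rw [integral_undef h] at h1
    norm_num at h1
  let σ : (Fin n → ℝ) → ℝ := fun y => d⁻¹ * ρ (T⁻¹ *ᵥ y)
  have hσ : ∀ x, σ (T *ᵥ x) = d⁻¹ * ρ x := by
    intro x; simp [σ, Matrix.mulVec_mulVec, Matrix.nonsing_inv_mul _ hu]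
  have e1 : ∀ x, σ (T *ᵥ x) * Real.log (σ (T *ᵥ x)) =
      d⁻¹ * (ρ x * Real.log (ρ x)) - d⁻¹ * Real.log d * ρ x := by
    intro x
    rw [hσ]
    by_cases hx : ρ x = 0
    · simp [hx]
    · rw [Real.log_mul (by positivity) hx, Real.log_inv]; ring
  have e2 : ∀ i j x, (T *ᵥ x) i * (T *ᵥ x) j * σ (T *ᵥ x) =
      ∑ k, ∑ l, (T i k * T j l * d⁻¹) * (x k * x l * ρ x) := by
    intro i j x
    rw [hσ]
    simp only [Matrix.mulVec, dotProduct]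
    rw [Finset.sum_mul_sum, Finset.sum_mul]
    refine Finset.sum_congr rfl fun k _ => ?_
    rw [Finset.sum_mul]
    refine Finset.sum_congr rfl fun l _ => ?_
    ring
  have e3 : ∀ x, U (T *ᵥ x) * σ (T *ᵥ x) = d⁻¹ * (U (T *ᵥ x) * ρ x) := by
    intro x; rw [hσ]; ring
  refine ⟨σ, ⟨?_, ?_, ?_, ?_, ?_⟩, ?_, ?_, ?_⟩
  · exact (hm.comp (Continuous.matrix_mulVec continuous_const continuous_id).measurable).const_mul _
  · intro x; exact mul_nonneg (by positivity) (h0 _)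
  · rw [lw_integral T hT]
    simp only [hσ]
    rw [integral_const_mul, h1, ← hd]; field_simp
  · intro i j
    apply lw_integrable T hT
    simp only [e2]
    exact integrable_finsetSum _ fun k _ => integrable_finsetSum _ fun l _ => (h2 k l).const_mul _
  · apply lw_integrable T hT
    simp only [e1]
    exact (hS.const_mul _).sub (hρi.const_mul _)
  · apply lw_integrable T hT
    simp only [e3]
    exact hUi.const_mul _
  · ext i j
    simp only [momMatrix, Matrix.of_apply]
    rw [lw_integral T hT]
    simp only [e2]
    rw [integral_finsetSum _ fun k _ => integrable_finsetSum _ fun l _ => (h2 k l).const_mul _]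
    have : ∀ k, ∫ x, ∑ l, (T i k * T j l * d⁻¹) * (x k * x l * ρ x) =
        ∑ l, (T i k * T j l * d⁻¹) * G k l := by
      intro k
      rw [integral_finsetSum _ fun l _ => (h2 k l).const_mul _]
      refine Finset.sum_congr rfl fun l _ => ?_
      rw [integral_const_mul, ← hG]; rfl
    simp only [this]
    simp only [Matrix.mul_apply, Matrix.transpose_apply]
    rw [Finset.mul_sum]
    simp only [Finset.mul_sum, Finset.sum_mul]
    rw [Finset.sum_comm]
    refine Finset.sum_congr rfl fun l _ => Finset.sum_congr rfl fun k _ => ?_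
    rw [← hd]; field_simp
  · unfold entropy
    rw [lw_integral T hT (fun x => σ x * Real.log (σ x)), lw_integral T hT (fun x => U x * σ x)]
    simp only [e1, e3]
    rw [integral_sub (hS.const_mul _) (hρi.const_mul _), integral_const_mul, integral_const_mul,
      integral_const_mul, h1, ← hd]
    field_simp; ring

theorem lw_bdd {n : ℕ} (U : (Fin n → ℝ) → ℝ) (hU : SuperQuadratic U)
    (G : Matrix (Fin n) (Fin n) ℝ) : BddAbove (LWset n U G) := by
  obtain ⟨hc, hg⟩ := hU
  have hg1 := hg (n + 1) (by positivity)
  obtain ⟨x0, hx0⟩ := Continuous.exists_forall_le (by fun_prop) hg1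
  set C := U x0 - (n + 1) * ‖x0‖ ^ 2 with hC
  have hlow : ∀ x, C + ∑ i, x i ^ 2 ≤ U x := by
    intro x
    have h := hx0 x
    have h3 : ∑ i, x i ^ 2 ≤ ∑ i : Fin n, ‖x‖ ^ 2 := by
      refine Finset.sum_le_sum fun i _ => ?_
      have := norm_le_pi_norm x i
      rw [← sq_abs]
      exact pow_le_pow_left₀ (abs_nonneg _) this 2
    simp at h3
    nlinarith [sq_nonneg ‖x‖]
  have hgi : Integrable fun x : Fin n → ℝ => Real.exp (-C) * ∏ i, Real.exp (-1 * (x i) ^ 2) :=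
    (Integrable.fintype_prod (f := fun _ : Fin n => fun t : ℝ => Real.exp (-1 * t ^ 2))
      (fun _ => integrable_exp_neg_mul_sq one_pos)).const_mul _
  refine ⟨∫ x : Fin n → ℝ, Real.exp (-C) * ∏ i, Real.exp (-1 * (x i) ^ 2), ?_⟩
  rintro r ⟨ρ, ⟨hm, h0, h1, h2, hS⟩, hUi, hG, rfl⟩
  unfold entropy
  rw [← integral_neg, ← integral_sub (f := fun x => -(ρ x * Real.log (ρ x))) hS.neg hUi]
  refine integral_mono (hS.neg.sub hUi) hgi ?_
  intro x
  have hE : Real.exp (-C) * ∏ i, Real.exp (-1 * (x i) ^ 2) = Real.exp (-(C + ∑ i, x i ^ 2)) := by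
    rw [← Real.exp_sum, ← Real.exp_add]; congr 1
    rw [← Finset.mul_sum]; ring
  have hle : Real.exp (-U x) ≤ Real.exp (-(C + ∑ i, x i ^ 2)) :=
    Real.exp_le_exp.mpr (by linarith [hlow x])
  show -(ρ x * Real.log (ρ x)) - U x * ρ x ≤ Real.exp (-C) * ∏ i, Real.exp (-1 * (x i) ^ 2)
  rw [hE]
  refine le_trans ?_ hle
  rcases (h0 x).eq_or_lt with h | h
  · rw [← h]; simp; positivity
  · have := Real.add_one_le_exp (-U x - Real.log (ρ x))
    rw [Real.exp_sub, Real.exp_log h, le_div_iff₀ h] at this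
    nlinarith

theorem lw_nonempty_one {n : ℕ} (V : (Fin n → ℝ) → ℝ) (hV : Continuous V) :
    (LWset n V 1).Nonempty := by
  set s := Real.sqrt 3 with hs
  have hsp : 0 < s := by positivity
  have hs2 : s ^ 2 = 3 := Real.sq_sqrt (by norm_num)
  set a : ℝ := (2 * s)⁻¹ with ha
  let g : ℝ → ℝ := (Set.Icc (-s) s).indicator (fun _ => a)
  let K : Set (Fin n → ℝ) := Set.Icc (fun _ => -s) (fun _ => s)
  have hK : IsCompact K := isCompact_Icc
  let ρ : (Fin n → ℝ) → ℝ := K.indicator (fun _ => a ^ n)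
  have hρ : ∀ x, ρ x = ∏ i, g (x i) := by
    intro x
    by_cases hx : x ∈ K
    · have : ∀ i, g (x i) = a := fun i =>
        Set.indicator_of_mem (show x i ∈ Set.Icc (-s) s from ⟨hx.1 i, hx.2 i⟩) _
      simp only [ρ, this]
      rw [Set.indicator_of_mem hx]; simp
    · have : ∃ i, x i ∉ Set.Icc (-s) s := by
        by_contra! h
        exact hx ⟨fun i => (h i).1, fun i => (h i).2⟩
      obtain ⟨i, hi⟩ := this
      simp only [ρ]
      rw [Set.indicator_of_notMem hx]
      exact (Finset.prod_eq_zero (Finset.mem_univ i) (Set.indicator_of_notMem hi _)).symm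
  have hint : ∀ f : (Fin n → ℝ) → ℝ, Continuous f → Integrable fun x => f x * ρ x := by
    intro f hf
    have : (fun x => f x * ρ x) = K.indicator (fun x => f x * a ^ n) := by
      ext x; by_cases hx : x ∈ K <;> simp [ρ, hx]
    rw [this, integrable_indicator_iff hK.measurableSet]
    exact (hf.mul continuous_const).continuousOn.integrableOn_compact hK
  have hI : ∀ f : ℝ → ℝ, ∫ t, f t * g t = a * ∫ t in (-s)..s, f t := by
    intro f
    have : (fun t => f t * g t) = (Set.Icc (-s) s).indicator (fun t => a * f t) := by
      ext t; by_cases ht : t ∈ Set.Icc (-s) s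
      · simp only [g]; rw [Set.indicator_of_mem ht, Set.indicator_of_mem ht]; ring
      · simp only [g]; rw [Set.indicator_of_notMem ht, Set.indicator_of_notMem ht]; ring
    rw [this, integral_indicator measurableSet_Icc, integral_Icc_eq_integral_Ioc,
      ← intervalIntegral.integral_of_le (by linarith), intervalIntegral.integral_const_mul]
  have m0 : ∫ t, g t = 1 := by
    have := hI (fun _ => 1)
    simp only [one_mul] at this
    rw [this, intervalIntegral.integral_const, ha, smul_eq_mul]; field_simp; ring
  have m1 : ∫ t, t * g t = 0 := by
    rw [hI (fun t => t), integral_id]; ring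
  have m2 : ∫ t, t * t * g t = 1 := by
    rw [hI (fun t => t * t)]
    have : (fun t : ℝ => t * t) = fun t => t ^ 2 := by ext t; ring
    rw [this, integral_pow, ha]; field_simp; norm_num; nlinarith
  have hmom : ∀ i j, ∫ x, x i * x j * ρ x = (1 : Matrix (Fin n) (Fin n) ℝ) i j := by
    intro i j
    have e : ∀ x : Fin n → ℝ, x i * x j * ρ x = ∏ k,
        (fun t => ((if k = i then t else 1) * (if k = j then t else 1)) * g t) (x k) := by
      intro x
      simp only [Finset.prod_mul_distrib, ← hρ]
      simp
    simp only [e]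
    rw [integral_fintype_prod_volume_eq_prod (fun k => 
      (fun t => ((if k = i then t else 1) * (if k = j then t else 1)) * g t))]
    by_cases hij : i = j
    · subst hij
      rw [Matrix.one_apply_eq]
      refine Finset.prod_eq_one fun k _ => ?_
      by_cases hk : k = i
      · simp [hk, m2]
      · simp [hk, m0]
    · rw [Matrix.one_apply_ne hij]
      refine Finset.prod_eq_zero (Finset.mem_univ i) ?_
      simp [hij, m1]
  refine ⟨_, ρ, ⟨?_, ?_, ?_, ?_, ?_⟩, hint V hV, ?_, rfl⟩
  · exact measurable_const.indicator hK.measurableSet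
  · intro x; exact Set.indicator_nonneg (fun _ _ => by positivity) x
  · simp only [hρ]
    rw [integral_fintype_prod_volume_eq_pow, m0, one_pow]
  · intro i j
    exact hint _ (by fun_prop)
  · have := hint (fun _ => Real.log (a ^ n)) continuous_const
    refine this.congr (Filter.Eventually.of_forall fun x => ?_)
    by_cases hx : x ∈ K <;> simp [ρ, hx, mul_comm]
  · ext i j; exact hmom i j

open scoped MatrixOrder Matrix.Norms.L2Operator in
theorem lw_factor {n : ℕ} (G : Matrix (Fin n) (Fin n) ℝ) (hG : G.PosDef) :
    ∃ B : Matrix (Fin n) (Fin n) ℝ, B.det ≠ 0 ∧ G = B * 1 * Bᵀ := by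
  obtain ⟨y, hy⟩ := CStarAlgebra.nonneg_iff_eq_star_mul_self.mp hG.posSemidef.nonneg
  have hy' : G = yᵀ * y := by rw [hy, Matrix.star_eq_conjTranspose]; simp
  refine ⟨yᵀ, ?_, by simpa using hy'⟩
  intro h
  have := hG.det_pos
  rw [hy', Matrix.det_mul, h] at this
  simp at this

/-- Transformation rule for the Luttinger-Ward functional: for every
invertible `T`, every symmetric positive definite `G`, and every interaction `U` with
superquadratic growth, `Φ[T G Tᵀ; U] = Φ[G; U ∘ T]`. -/
theorem statement11 (n : ℕ) (hn : 1 ≤ n) (U : (Fin n → ℝ) → ℝ) (hU : SuperQuadratic U)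
    (T : Matrix (Fin n) (Fin n) ℝ) (hT : IsUnit T)
    (G : Matrix (Fin n) (Fin n) ℝ) (hG : G.PosDef) :
    Phi n U (T * G * Tᵀ) = Phi n (fun x => U (T.mulVec x)) G := by
  have hu : IsUnit T.det := (Matrix.isUnit_iff_isUnit_det T).mp hT
  have hd : T.det ≠ 0 := hu.ne_zero
  have hset : LWset n U (T * G * Tᵀ) =
      (fun r => r + Real.log |T.det|) '' LWset n (fun x => U (T *ᵥ x)) G := by
    ext r
    constructor
    · intro hr
      refine ⟨r - Real.log |T.det|, ?_, by simp⟩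
      have hd' : (T⁻¹).det ≠ 0 := by
        rw [Matrix.det_nonsing_inv, Ring.inverse_eq_inv']; exact inv_ne_zero hd
      have h1 : (fun x => (fun x => U (T *ᵥ x)) (T⁻¹ *ᵥ x)) = U := by
        ext x; simp [Matrix.mulVec_mulVec, Matrix.mul_nonsing_inv _ hu]
      have := lw_transform (fun x => U (T *ᵥ x)) T⁻¹ hd' (T * G * Tᵀ) r (by rw [h1]; exact hr)
      have h2 : T⁻¹ * (T * G * Tᵀ) * (T⁻¹)ᵀ = G := by
        rw [Matrix.mul_assoc, Matrix.mul_assoc (T * G), ← Matrix.transpose_mul,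
          Matrix.nonsing_inv_mul _ hu, Matrix.transpose_one, Matrix.mul_one, ← Matrix.mul_assoc,
          Matrix.nonsing_inv_mul _ hu, Matrix.one_mul]
      rw [h2, Matrix.det_nonsing_inv, Ring.inverse_eq_inv', abs_inv, Real.log_inv,
        ← sub_eq_add_neg] at this
      exact this
    · rintro ⟨r, hr, rfl⟩
      exact lw_transform U T hd G r hr
  have hne : (LWset n (fun x => U (T *ᵥ x)) G).Nonempty := by
    obtain ⟨B, hB, hGB⟩ := lw_factor G hG
    obtain ⟨r, hr⟩ := lw_nonempty_one (fun x => U (T *ᵥ (B *ᵥ x)))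
      (hU.1.comp (Continuous.matrix_mulVec continuous_const
        (Continuous.matrix_mulVec continuous_const continuous_id)))
    rw [hGB]
    exact ⟨_, lw_transform (fun x => U (T *ᵥ x)) B hB 1 r hr⟩
  have hbdd : BddAbove (LWset n (fun x => U (T *ᵥ x)) G) := by
    obtain ⟨M, hM⟩ := lw_bdd U hU (T * G * Tᵀ)
    refine ⟨M - Real.log |T.det|, fun r hr => ?_⟩
    have := hM (lw_transform U T hd G r hr)
    linarith
  have hF : Ffun n U (T * G * Tᵀ) = Ffun n (fun x => U (T *ᵥ x)) G + Real.log |T.det| := by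
    change sSup (LWset n U (T * G * Tᵀ)) = sSup (LWset n (fun x => U (T *ᵥ x)) G) + _
    rw [hset]
    exact ((OrderIso.addRight (Real.log |T.det|)).map_csSup' hne hbdd).symm
  unfold Phi
  rw [hF, Matrix.det_mul, Matrix.det_mul, Matrix.det_transpose,
    Real.log_mul (mul_ne_zero hd hG.det_pos.ne') hd, Real.log_mul hd hG.det_pos.ne', Real.log_abs]
  ring
end
end
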